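/- arXiv:2006.13449 — 8 statements merged into one kernel-verified Lean document; each statement's English description precedes it below -/
import Mathlib

section
/- Let G be a simple graph on vertex set {v_1,…,v_n} and let X_1,…,X_n,X'_1,…,X'_n be the Jiang–Li strings of G. If G contains a clique of size c, then there exists a common subsequence of X_1,…,X_n,X'_1,…,X'_n of length c. -/
/-- The maximum length of a common subsequence of two strings (lists). -/
noncomputable def lcsLen {α : Type*} (S T : List α) : ℕ :=
  sSup {k | ∃ Z : List α, Z.Sublist S ∧ Z.Sublist T ∧ Z.length = k}

/-- The Jiang–Li string `X_i = v_1 ⋯ v_{i-1} v_{i+1} ⋯ v_n v_i v_{i_r} ⋯ v_{i_s}`,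
where `v_{i_r}, …, v_{i_s}` are the neighbours of `v_i` with larger index,
listed in increasing order. -/
def JLX {n : ℕ} (G : SimpleGraph (Fin n)) [DecidableRel G.Adj] (i : Fin n) : List (Fin n) :=
  (List.finRange n).filter (fun j => decide (j ≠ i)) ++ [i] ++
    (List.finRange n).filter (fun j => decide (G.Adj i j ∧ i < j))

/-- The Jiang–Li string `X'_i = v_{i_p} ⋯ v_{i_q} v_i v_1 ⋯ v_{i-1} v_{i+1} ⋯ v_n`,
where `v_{i_p}, …, v_{i_q}` are the neighbours of `v_i` with smaller index,
listed in increasing order. -/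
def JLX' {n : ℕ} (G : SimpleGraph (Fin n)) [DecidableRel G.Adj] (i : Fin n) : List (Fin n) :=
  (List.finRange n).filter (fun j => decide (G.Adj i j ∧ j < i)) ++ [i] ++
    (List.finRange n).filter (fun j => decide (j ≠ i))

/-- A strictly increasing list all of whose entries satisfy `p` embeds in the filtered range. -/
theorem sublist_filter_finRange {n : ℕ} (p : Fin n → Bool) (M : List (Fin n))
    (hM : M.Pairwise (· < ·)) (hp : ∀ x ∈ M, p x = true) :
    M.Sublist ((List.finRange n).filter p) := by
  have h1 : M.Sublist (List.finRange n) := by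
    apply List.sublist_of_subperm_of_pairwise (r := (· < ·)) _ hM (List.pairwise_lt_finRange n)
    exact List.subperm_of_subset (hM.imp (fun h => ne_of_lt h)) (fun x _ => List.mem_finRange x)
  have h2 := h1.filter p
  rwa [List.filter_eq_self.2 hp] at h2

/-- If `G` contains a clique of size `c`, then there is a common subsequence of
`X_1, …, X_n, X'_1, …, X'_n` of length `c`. -/
theorem stmt0 {n c : ℕ} (G : SimpleGraph (Fin n)) [DecidableRel G.Adj]
    (s : Finset (Fin n)) (hclique : G.IsNClique c s) :
    ∃ L : List (Fin n), L.length = c ∧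
      ∀ i : Fin n, L.Sublist (JLX G i) ∧ L.Sublist (JLX' G i) := by
  have hs : (s.sort (· ≤ ·)).Pairwise (· < ·) := s.sortedLT_sort.pairwise
  have hmem : ∀ x, x ∈ s.sort (· ≤ ·) ↔ x ∈ s := fun x => Finset.mem_sort _
  refine ⟨s.sort (· ≤ ·), by rw [Finset.length_sort]; exact hclique.card_eq, fun i => ?_⟩
  generalize s.sort (· ≤ ·) = L at hs hmem
  unfold JLX JLX'
  by_cases hi : i ∈ s
  · obtain ⟨a, b, rfl⟩ := List.append_of_mem ((hmem i).2 hi)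
    have hadj : ∀ x, x ∈ a ++ i :: b → i ≠ x → G.Adj i x := fun x hx hne =>
      hclique.isClique (Finset.mem_coe.2 hi) (Finset.mem_coe.2 ((hmem x).1 hx)) hne
    rw [List.pairwise_append, List.pairwise_cons] at hs
    obtain ⟨ha, ⟨hib, hb⟩, hab⟩ := hs
    have hai : ∀ x ∈ a, x < i := fun x hx => hab x hx i (by simp)
    rw [show a ++ i :: b = a ++ [i] ++ b by simp]
    constructor
    · refine ((sublist_filter_finRange _ a ha ?_).append (List.Sublist.refl _)).append
        (sublist_filter_finRange _ b hb ?_)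
      · intro x hx; simpa using (hai x hx).ne
      · intro x hx; simpa using ⟨hadj x (by simp [hx]) (hib x hx).ne, hib x hx⟩
    · refine ((sublist_filter_finRange _ a ha ?_).append (List.Sublist.refl _)).append
        (sublist_filter_finRange _ b hb ?_)
      · intro x hx; simpa using ⟨hadj x (by simp [hx]) (hai x hx).ne', hai x hx⟩
      · intro x hx; simpa using (hib x hx).ne'
  · have h := sublist_filter_finRange (fun j => decide (j ≠ i)) L hs (by
      intro x hx
      have : x ≠ i := fun h => hi (h ▸ (hmem x).1 hx)
      simpa using this)
    constructor
    · rw [List.append_assoc]; exact h.trans (List.sublist_append_left _ _)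
    · exact h.trans (List.sublist_append_right _ _)
end

section
/- Let G be a simple graph on vertex set {v_1,…,v_n} with n ≥ 1 and let X_1,…,X_n,X'_1,…,X'_n be the Jiang–Li strings of G. Then the maximum length of a common subsequence of X_1,…,X_n,X'_1,…,X'_n is equal to the maximum size of a clique in G. -/
theorem sub_filter_aux {n : ℕ} (L : List (Fin n)) (p : Fin n → Bool)
    (h : L.Sublist (List.finRange n)) (hp : ∀ a ∈ L, p a = true) :
    L.Sublist ((List.finRange n).filter p) := by
  have := h.filter p
  rwa [List.filter_eq_self.2 hp] at this

theorem pair_aux {n : ℕ} (G : SimpleGraph (Fin n)) [DecidableRel G.Adj] (a b : Fin n)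
    (h : [a, b].Sublist (JLX G a)) : G.Adj a b ∧ a < b := by
  unfold JLX at h
  rw [List.append_assoc] at h
  obtain ⟨l1, l2, e, h1, h2⟩ := List.sublist_append_iff.1 h
  have h3 : l1 = [] := by
    cases l1 with
    | nil => rfl
    | cons c t =>
      simp only [List.cons_append, List.cons.injEq] at e
      have := h1.subset (List.mem_cons_self)
      simp [← e.1] at this
  subst h3
  simp only [List.nil_append] at e
  subst e
  simp only [List.singleton_append] at h2
  have h4 := (List.cons_sublist_cons.1 h2).subset (List.mem_singleton_self b)
  simpa using h4

theorem clique_aux {n : ℕ} (G : SimpleGraph (Fin n)) [DecidableRel G.Adj] (L : List (Fin n))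
    (hL : L.Sublist (List.finRange n)) (hc : ∀ a ∈ L, ∀ b ∈ L, a ≠ b → G.Adj a b) (i : Fin n) :
    L.Sublist (JLX G i) ∧ L.Sublist (JLX' G i) := by
  have hs : L.Pairwise (· < ·) := (List.pairwise_lt_finRange n).sublist hL
  by_cases hi : i ∈ L
  · obtain ⟨A, B, rfl⟩ := List.append_of_mem hi
    rw [List.pairwise_append, List.pairwise_cons] at hs
    obtain ⟨_, ⟨hB, _⟩, hA⟩ := hs
    have hA' : ∀ a ∈ A, a < i := fun a ha => hA a ha i (by simp)
    have sA : A.Sublist (List.finRange n) := (List.sublist_append_left _ _).trans hL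
    have sB : B.Sublist (List.finRange n) :=
      ((List.sublist_cons_self _ _).trans (List.sublist_append_right _ _)).trans hL
    have e : A ++ i :: B = A ++ [i] ++ B := by simp
    rw [e]
    unfold JLX JLX'
    constructor
    · refine ((sub_filter_aux A _ sA ?_).append (List.Sublist.refl _)).append
        (sub_filter_aux B _ sB ?_)
      · intro a ha; simpa using (hA' a ha).ne
      · intro a ha
        simpa using ⟨hc i (by simp) a (by simp [ha]) (hB a ha).ne, hB a ha⟩
    · refine ((sub_filter_aux A _ sA ?_).append (List.Sublist.refl _)).append
        (sub_filter_aux B _ sB ?_)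
      · intro a ha
        simpa using ⟨hc i (by simp) a (by simp [ha]) (hA' a ha).ne', hA' a ha⟩
      · intro a ha; simpa using (hB a ha).ne'
  · have key := sub_filter_aux L (fun j => decide (j ≠ i)) hL (by
      intro a ha; have : a ≠ i := fun h => hi (h ▸ ha)
      simpa using this)
    unfold JLX JLX'
    exact ⟨(key.trans (List.sublist_append_left _ _)).trans (List.sublist_append_left _ _),
      key.trans (List.sublist_append_right _ _)⟩

/-- For `n ≥ 1`, the maximum length of a common subsequence of
`X_1, …, X_n, X'_1, …, X'_n` equals the maximum size of a clique in `G`. -/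
theorem stmt2 {n : ℕ} (hn : 1 ≤ n) (G : SimpleGraph (Fin n)) [DecidableRel G.Adj] :
    sSup {l | ∃ L : List (Fin n),
        (∀ i : Fin n, L.Sublist (JLX G i) ∧ L.Sublist (JLX' G i)) ∧ L.length = l}
      = sSup {c | ∃ s : Finset (Fin n), G.IsNClique c s} := by
  congr 1
  ext c
  constructor
  · rintro ⟨L, hL, rfl⟩
    have hp : L.Pairwise (fun a b => G.Adj a b ∧ a < b) := by
      rw [List.pairwise_iff_forall_sublist]
      intro a b hab
      exact pair_aux G a b (hab.trans (hL a).1)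
    have hnd : L.Nodup := hp.imp (fun h => h.2.ne)
    refine ⟨L.toFinset, ?_, List.toFinset_card_of_nodup hnd⟩
    have hp' : L.Pairwise G.Adj := hp.imp (fun h => h.1)
    intro a ha b hb hab
    have : Std.Symm G.Adj := ⟨fun _ _ h => h.symm⟩
    exact hp'.forall (by simpa using ha) (by simpa using hb) hab
  · rintro ⟨s, hs⟩
    refine ⟨(List.finRange n).filter (fun j => decide (j ∈ s)), ?_, ?_⟩
    · apply clique_aux G _ List.filter_sublist
      intro a ha b hb hab
      exact hs.1 (by simpa using ha) (by simpa using hb) hab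
    · have hnd : ((List.finRange n).filter (fun j => decide (j ∈ s))).Nodup :=
        (List.nodup_finRange n).filter _
      rw [← List.toFinset_card_of_nodup hnd, ← hs.2]
      congr 1
      ext a
      simp
end

section
/- There exist constants c > 0 and C > 0 such that for every α ∈ (0,1) and every integer n ≥ 2 there is a finite alphabet Σ' with |Σ'| ≤ C·α^{−2} such that for every integer m ≥ c·α^{−1}·ln n, if S_1,…,S_n are chosen independently and uniformly at random from Σ'^m, then with probability at least 1 − 1/n it holds that LCS(S_i,S_j) ≤ α·m for every pair i ≠ j. -/
open Classical in
lemma aux_count {n m q k : ℕ} (i j : Fin n) (hij : i ≠ j) (a b : Fin k ↪o Fin m) :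
    (Finset.univ.filter (fun f : Fin n → Fin m → Fin q => ∀ r, f i (a r) = f j (b r))).card * q ^ k
      ≤ Fintype.card (Fin n → Fin m → Fin q) := by
  set s := Finset.univ.filter (fun f : Fin n → Fin m → Fin q => ∀ r, f i (a r) = f j (b r)) with hs
  -- modify the values of `f j` on the range of `b`
  let F : s × (Fin k → Fin q) → (Fin n → Fin m → Fin q) := fun p u v =>
    if h : u = j ∧ ∃ r, b r = v then p.2 h.2.choose else p.1.1 u v
  have hF : Function.Injective F := by
    rintro ⟨⟨f, hf⟩, g⟩ ⟨⟨f', hf'⟩, g'⟩ h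
    simp only [hs, Finset.mem_filter, Finset.mem_univ, true_and] at hf hf'
    have h1 : ∀ u v, ¬ (u = j ∧ ∃ r, b r = v) → f u v = f' u v := by
      intro u v huv
      have := congrFun (congrFun h u) v
      simpa only [F, dif_neg huv] using this
    have hg : g = g' := by
      funext r
      have hr : j = j ∧ ∃ r', b r' = b r := ⟨rfl, r, rfl⟩
      have := congrFun (congrFun h j) (b r)
      simp only [F, dif_pos hr] at this
      have hc : hr.2.choose = r := b.injective hr.2.choose_spec
      rwa [hc] at this
    have hff : f = f' := by
      funext u v
      by_cases huv : u = j ∧ ∃ r, b r = v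
      · obtain ⟨rfl, r, rfl⟩ := huv
        rw [← hf, ← hf']
        exact h1 _ _ (fun h => hij h.1)
      · exact h1 u v huv
    subst hff; subst hg; rfl
  have := Fintype.card_le_of_injective F hF
  simpa using this

lemma aux_lcs {m q k : ℕ} (S T : Fin m → Fin q) (h : k ≤ lcsLen (List.ofFn S) (List.ofFn T)) :
    ∃ a b : Fin k ↪o Fin m, ∀ r, S (a r) = T (b r) := by
  have hmem : lcsLen (List.ofFn S) (List.ofFn T) ∈
      {k | ∃ Z : List (Fin q), Z.Sublist (List.ofFn S) ∧ Z.Sublist (List.ofFn T) ∧ Z.length = k} := by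
    apply Nat.sSup_mem
    · exact ⟨0, [], by simp, by simp, rfl⟩
    · refine ⟨m, ?_⟩
      rintro x ⟨Z, h1, -, rfl⟩
      simpa using h1.length_le
  obtain ⟨Z, h1, h2, h3⟩ := hmem
  rw [← h3] at h
  have key : ∀ U : Fin m → Fin q, Z.Sublist (List.ofFn U) →
      ∃ a : Fin k ↪o Fin m, ∀ r : Fin k, U (a r) = Z.get (Fin.castLE h r) := by
    intro U hU
    obtain ⟨e, he⟩ := List.sublist_iff_exists_fin_orderEmbedding_get_eq.1 hU
    refine ⟨((Fin.castLEOrderEmb h).trans e).trans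
      (Fin.castOrderIso (List.length_ofFn)).toOrderEmbedding, ?_⟩
    intro r
    have := he (Fin.castLE h r)
    rw [this]
    simp
    rfl
  obtain ⟨a, ha⟩ := key S h1
  obtain ⟨b, hb⟩ := key T h2
  exact ⟨a, b, fun r => by rw [ha, hb]⟩

lemma aux_card (k m : ℕ) : Nat.card (Fin k ↪o Fin m) = m.choose k := by
  rw [Nat.card_congr Set.powersetCard.ofFinEmbEquiv]
  rw [Set.powersetCard.card]
  simp

lemma aux_real (α : ℝ) (h0 : 0 < α) (n m q k : ℕ) (hn : 2 ≤ n)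
    (hq : Real.exp 5 / α ^ 2 ≤ q) (hk : α * m ≤ k) (hm : Real.log n ≤ α * m) :
    (n : ℝ) ^ 3 * (m.choose k : ℝ) ^ 2 ≤ (q : ℝ) ^ k := by
  have hn0 : (0 : ℝ) < n := by positivity
  have h1 : (n : ℝ) ^ 3 ≤ Real.exp 3 ^ k := by
    calc (n : ℝ) ^ 3 = Real.exp (Real.log n) ^ 3 := by rw [Real.exp_log hn0]
      _ ≤ Real.exp k ^ 3 := by gcongr; linarith
      _ = _ := by rw [← Real.exp_nat_mul, ← Real.exp_nat_mul]; push_cast; ring_nf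
  have h2 : (m.choose k : ℝ) ≤ (Real.exp 1 / α) ^ k := by
    have hmk : (m : ℝ) ≤ k / α := by rw [le_div_iff₀ h0]; linarith
    have hf : (0 : ℝ) < k.factorial := by positivity
    calc (m.choose k : ℝ) ≤ (m : ℝ) ^ k / k.factorial := Nat.choose_le_pow_div k m
      _ ≤ (k / α) ^ k / k.factorial := by gcongr
      _ = ((k : ℝ) ^ k / k.factorial) / α ^ k := by rw [div_pow]; ring
      _ ≤ Real.exp k / α ^ k := by
        gcongr
        exact Real.pow_div_factorial_le_exp _ (by positivity) _
      _ = _ := by rw [div_pow, ← Real.exp_nat_mul, mul_one]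
  calc (n : ℝ) ^ 3 * (m.choose k : ℝ) ^ 2 ≤ Real.exp 3 ^ k * ((Real.exp 1 / α) ^ k) ^ 2 := by gcongr
    _ = (Real.exp 5 / α ^ 2) ^ k := by
      rw [← pow_mul, mul_comm k 2, pow_mul, ← mul_pow]
      congr 1
      rw [div_pow, ← Real.exp_nat_mul, ← mul_div_assoc, ← Real.exp_add]
      norm_num
    _ ≤ _ := by gcongr

/-- There are constants `c, C > 0` such that for every `α ∈ (0,1)` and `n ≥ 2`
there is an alphabet of size at most `C·α⁻²` (taken to be `Fin q`) such that for
every `m ≥ c·α⁻¹·ln n`, a uniformly random `n`-tuple of strings from `Σ'^m`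
satisfies `LCS(S_i,S_j) ≤ α·m` for all `i ≠ j` with probability at least `1 − 1/n`
(expressed as a counting fraction). -/
theorem stmt4 :
    ∃ c : ℝ, 0 < c ∧ ∃ C : ℝ, 0 < C ∧
      ∀ α : ℝ, 0 < α → α < 1 → ∀ n : ℕ, 2 ≤ n →
        ∃ q : ℕ, (q : ℝ) ≤ C / α ^ 2 ∧
          ∀ m : ℕ, c * α⁻¹ * Real.log n ≤ (m : ℝ) →
            1 - 1 / (n : ℝ) ≤
              ((Nat.card {f : Fin n → Fin m → Fin q //
                  ∀ i j : Fin n, i ≠ j →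
                    ((lcsLen (List.ofFn (f i)) (List.ofFn (f j)) : ℕ) : ℝ) ≤ α * m} : ℝ) /
                (Fintype.card (Fin n → Fin m → Fin q) : ℝ)) := by
  classical
  refine ⟨1, one_pos, Real.exp 5 + 1, by positivity, ?_⟩
  intro α h0 h1 n hn
  refine ⟨⌈Real.exp 5 / α ^ 2⌉₊, ?_, ?_⟩
  · have := (Nat.ceil_lt_add_one (a := Real.exp 5 / α ^ 2) (by positivity)).le
    refine this.trans ?_
    rw [add_div]
    gcongr
    rw [le_div_iff₀ (by positivity)]
    nlinarith
  intro m hm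
  have hq : Real.exp 5 / α ^ 2 ≤ (⌈Real.exp 5 / α ^ 2⌉₊ : ℝ) := Nat.le_ceil _
  generalize ⌈Real.exp 5 / α ^ 2⌉₊ = q at hq
  have hn0 : (0 : ℝ) < n := by positivity
  have hq0 : (0 : ℝ) < q := lt_of_lt_of_le (by positivity) hq
  have hm' : Real.log n ≤ α * m := by
    rw [one_mul, inv_mul_le_iff₀ h0] at hm
    exact hm
  set k := ⌊α * m⌋₊ + 1 with hk
  have hkm : α * m ≤ k := by
    have := (Nat.lt_floor_add_one (α * m)).le
    rw [hk]; push_cast; exact this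
  have hreal := aux_real α h0 n m q k hn hq hkm hm'
  have : Fintype (Fin k ↪o Fin m) := Fintype.ofFinite _
  set N := Fintype.card (Fin n → Fin m → Fin q) with hN
  have hNpos : (0 : ℝ) < N := by
    have : 0 < q := by exact_mod_cast hq0
    have : Nonempty (Fin q) := ⟨⟨0, this⟩⟩
    exact_mod_cast Fintype.card_pos
  let good : (Fin n → Fin m → Fin q) → Prop := fun f => ∀ i j : Fin n, i ≠ j →
    ((lcsLen (List.ofFn (f i)) (List.ofFn (f j)) : ℕ) : ℝ) ≤ α * m
  change _ ≤ (Nat.card {f // good f} : ℝ) / _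
  rw [Nat.card_eq_fintype_card, Fintype.card_subtype]
  have hsplit := Finset.card_filter_add_card_filter_not
    (s := (Finset.univ : Finset (Fin n → Fin m → Fin q))) good
  rw [Finset.card_univ, ← hN] at hsplit
  set bad := Finset.univ.filter (fun f => ¬ good f) with hbad
  let I := ((Finset.univ : Finset (Fin n × Fin n)).filter (fun p => p.1 ≠ p.2)) ×ˢ
    (Finset.univ : Finset ((Fin k ↪o Fin m) × (Fin k ↪o Fin m)))
  have hsub : bad ⊆ I.biUnion (fun p => Finset.univ.filter
      (fun f : Fin n → Fin m → Fin q => ∀ r, f p.1.1 (p.2.1 r) = f p.1.2 (p.2.2 r))) := by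
    intro f hf
    simp only [hbad, Finset.mem_filter, Finset.mem_univ, true_and, good] at hf
    push Not at hf
    obtain ⟨i, j, hij, hlt⟩ := hf
    have hle : k ≤ lcsLen (List.ofFn (f i)) (List.ofFn (f j)) := by
      rw [hk]
      exact Nat.succ_le_of_lt ((Nat.floor_lt (by positivity)).2 hlt)
    obtain ⟨a, b, hab⟩ := aux_lcs _ _ hle
    simp only [Finset.mem_biUnion]
    exact ⟨((i, j), (a, b)), by simp [I, hij], by simpa using hab⟩
  have hcard : bad.card * q ^ k ≤ I.card * N := by
    refine (Nat.mul_le_mul_right _ ((Finset.card_le_card hsub).trans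
      Finset.card_biUnion_le)).trans ?_
    rw [Finset.sum_mul]
    refine (Finset.sum_le_card_nsmul _ _ N ?_).trans (by simp)
    rintro ⟨⟨i, j⟩, a, b⟩ hp
    have hij : i ≠ j := by simpa [I] using hp
    exact aux_count i j hij a b
  have hI : I.card ≤ n ^ 2 * (m.choose k) ^ 2 := by
    have hc : Fintype.card (Fin k ↪o Fin m) = m.choose k := by
      rw [← Nat.card_eq_fintype_card, aux_card]
    simp only [I, Finset.card_product, Finset.card_univ, Fintype.card_prod, hc]
    refine Nat.mul_le_mul ((Finset.card_le_univ _).trans (by simp [sq])) (by rw [sq])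
  have hb : (bad.card : ℝ) * n ≤ N := by
    have hqk : (0 : ℝ) < (q : ℝ) ^ k := by positivity
    refine le_of_mul_le_mul_right ?_ hqk
    have h3 : (bad.card : ℝ) * q ^ k ≤ I.card * N := by exact_mod_cast hcard
    have h4 : (I.card : ℝ) ≤ n ^ 2 * (m.choose k : ℝ) ^ 2 := by exact_mod_cast hI
    calc (bad.card : ℝ) * n * q ^ k = n * (bad.card * q ^ k) := by ring
      _ ≤ n * (n ^ 2 * (m.choose k : ℝ) ^ 2 * N) := by
        refine mul_le_mul_of_nonneg_left (h3.trans ?_) hn0.le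
        gcongr
      _ = N * (n ^ 3 * (m.choose k : ℝ) ^ 2) := by ring
      _ ≤ N * q ^ k := by gcongr
  have hs : ((Finset.univ.filter good).card : ℝ) + bad.card = N := by exact_mod_cast hsplit
  rw [le_div_iff₀ hNpos]
  have h5 : (bad.card : ℝ) ≤ N / n := by rw [le_div_iff₀ hn0]; exact hb
  have h6 : (1 - 1 / (n : ℝ)) * N = N - N / n := by ring
  rw [h6]
  linarith
end

section
/- There exists a constant C > 0 such that for every α ∈ (0,1) and every integer n ≥ 2 there is a finite alphabet Σ' with |Σ'| ≤ C·α^{−3} such that for every integer m > 2·α^{−2}·ln n there exist strings S_1,…,S_n ∈ Σ'^m satisfying LCS(S_i,S_j) ≤ α·m for every pair i ≠ j. -/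
theorem aux_card_emb (k m : ℕ) : Nat.card (Fin k ↪o Fin m) ≤ m.choose k := by
  classical
  have h : Nat.card (Fin k ↪o Fin m) ≤
      Nat.card ((Finset.univ : Finset (Fin m)).powersetCard k) := by
    refine Nat.card_le_card_of_injective
      (fun e => ⟨Finset.univ.map e.toEmbedding, ?_⟩) ?_
    · simp [Finset.mem_powersetCard]
    · intro e e' h
      have h1 := congrArg Subtype.val h
      have h2 : Set.range e = Set.range e' := by
        ext x
        have := Finset.ext_iff.1 h1 x
        simpa using this
      exact (OrderEmbedding.range_inj).1 h2
  simpa using h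

theorem aux_fiber (k m q : ℕ) (j : Fin k ↪o Fin m) (u : Fin k → Fin q) :
    (Finset.univ.filter (fun g : Fin m → Fin q => ∀ t, g (j t) = u t)).card * q ^ k ≤ q ^ m := by
  classical
  have h := Fintype.card_le_of_injective
    (fun p : {g : Fin m → Fin q // ∀ t, g (j t) = u t} × (Fin k → Fin q) =>
      (fun x => if h : ∃ t, j t = x then p.2 h.choose else p.1.1 x : Fin m → Fin q)) ?_
  · simpa [Fintype.card_subtype] using h
  · rintro ⟨⟨g, hg⟩, h⟩ ⟨⟨g', hg'⟩, h'⟩ H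
    simp only at H
    have hh : h = h' := by
      funext t
      have := congrFun H (j t)
      have hex : ∃ s, j s = j t := ⟨t, rfl⟩
      have e : hex.choose = t := j.injective hex.choose_spec
      simp only [dif_pos hex, e] at this
      exact this
    have hgg : g = g' := by
      funext x
      by_cases hx : ∃ t, j t = x
      · obtain ⟨t, rfl⟩ := hx
        rw [hg, hg']
      · have := congrFun H x
        simpa only [dif_neg hx] using this
    subst hh hgg
    rfl

theorem aux_bad (k m q : ℕ) (f : Fin m → Fin q) [DecidablePred fun g : Fin m → Fin q =>
      k ≤ lcsLen (List.ofFn f) (List.ofFn g)] :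
    (Finset.univ.filter (fun g : Fin m → Fin q =>
      k ≤ lcsLen (List.ofFn f) (List.ofFn g))).card * q ^ k ≤ (m.choose k) ^ 2 * q ^ m := by
  classical
  have : Fintype (Fin k ↪o Fin m) := Fintype.ofFinite _
  have hsub : (Finset.univ.filter (fun g : Fin m → Fin q =>
      k ≤ lcsLen (List.ofFn f) (List.ofFn g))) ⊆
      (Finset.univ : Finset ((Fin k ↪o Fin m) × (Fin k ↪o Fin m))).biUnion
        (fun p => Finset.univ.filter (fun g : Fin m → Fin q => ∀ t, g (p.2 t) = f (p.1 t))) := by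
    intro g hg
    simp only [Finset.mem_filter, Finset.mem_univ, true_and, Finset.mem_biUnion] at hg ⊢
    have hmem : lcsLen (List.ofFn f) (List.ofFn g) ∈
        {k | ∃ Z : List (Fin q), Z.Sublist (List.ofFn f) ∧ Z.Sublist (List.ofFn g) ∧
          Z.length = k} := by
      refine Nat.sSup_mem ⟨0, [], by simp⟩ ⟨m, ?_⟩
      rintro _ ⟨Z, h1, -, rfl⟩
      simpa using h1.length_le
    obtain ⟨Z, h1, h2, h3⟩ := hmem
    have hl : (Z.take k).length = k := by simp; omega
    have key : ∀ f : Fin m → Fin q, Z.Sublist (List.ofFn f) →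
        ∃ i : Fin k ↪o Fin m, ∀ t : Fin k, f (i t) = (Z.take k)[t]'(by omega) := by
      intro f h
      obtain ⟨e, he⟩ := List.sublist_iff_exists_fin_orderEmbedding_get_eq.1
        ((List.take_sublist k Z).trans h)
      refine ⟨((Fin.castOrderIso hl.symm).toOrderEmbedding.trans e).trans
        (Fin.castOrderIso (by simp)).toOrderEmbedding, fun t => ?_⟩
      have := he (Fin.cast hl.symm t)
      simp at this
      simp [this]
      rfl
    obtain ⟨i, hi⟩ := key f h1
    obtain ⟨j, hj⟩ := key g h2
    exact ⟨(i, j), fun t => by rw [hi, hj]⟩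
  have hc := aux_card_emb k m
  rw [Nat.card_eq_fintype_card] at hc
  calc _ ≤ (∑ p : (Fin k ↪o Fin m) × (Fin k ↪o Fin m),
        (Finset.univ.filter (fun g : Fin m → Fin q => ∀ t, g (p.2 t) = f (p.1 t))).card) * q ^ k :=
        Nat.mul_le_mul_right _ ((Finset.card_le_card hsub).trans Finset.card_biUnion_le)
    _ = ∑ p : (Fin k ↪o Fin m) × (Fin k ↪o Fin m),
        (Finset.univ.filter (fun g : Fin m → Fin q => ∀ t, g (p.2 t) = f (p.1 t))).card * q ^ k :=
        Finset.sum_mul _ _ _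
    _ ≤ ∑ _p : (Fin k ↪o Fin m) × (Fin k ↪o Fin m), q ^ m :=
        Finset.sum_le_sum fun p _ => aux_fiber k m q p.2 (fun t => f (p.1 t))
    _ = (Fintype.card (Fin k ↪o Fin m)) ^ 2 * q ^ m := by simp [sq]
    _ ≤ _ := Nat.mul_le_mul_right _ (Nat.pow_le_pow_left hc 2)

theorem aux_greedy {X : Type*} [Fintype X] (R : X → X → Prop) [DecidableRel R]
    (hs : ∀ x y, R x y → R y x) (B n : ℕ)
    (hB : ∀ x, (Finset.univ.filter (fun y => R x y)).card ≤ B) (hn : n * B < Fintype.card X) :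
    ∃ S : Fin n → X, ∀ i j, i ≠ j → ¬ R (S i) (S j) := by
  classical
  induction n with
  | zero => exact ⟨fun i => i.elim0, fun i => i.elim0⟩
  | succ n ih =>
    obtain ⟨S, hS⟩ := ih (lt_of_le_of_lt (Nat.mul_le_mul_right _ (Nat.le_succ n)) hn)
    have : ∃ y, y ∉ (Finset.univ : Finset (Fin n)).biUnion
        (fun i => Finset.univ.filter (fun y => R (S i) y)) := by
      by_contra! hcon
      have h1 : Fintype.card X ≤ n * B := by
        rw [← Finset.card_univ, ← Finset.eq_univ_iff_forall.2 hcon]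
        refine Finset.card_biUnion_le.trans ((Finset.sum_le_sum fun i _ => hB (S i)).trans ?_)
        simp
      have h2 : n * B ≤ (n + 1) * B := Nat.mul_le_mul_right B (Nat.le_succ n)
      omega
    obtain ⟨y, hy⟩ := this
    simp only [Finset.mem_biUnion, Finset.mem_filter, Finset.mem_univ, true_and, not_exists] at hy
    refine ⟨Fin.cons y S, fun i j hij => ?_⟩
    induction i using Fin.cases with
    | zero =>
      induction j using Fin.cases with
      | zero => exact absurd rfl hij
      | succ j => simpa using fun h => hy j (hs _ _ h)
    | succ i =>
      induction j using Fin.cases with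
      | zero => simpa using hy i
      | succ j => simpa using hS i j (fun h => hij (by rw [h]))

theorem aux_symm {α : Type*} (S T : List α) : lcsLen S T = lcsLen T S := by
  unfold lcsLen
  congr 1
  ext k
  exact ⟨fun ⟨Z, a, b, c⟩ => ⟨Z, b, a, c⟩, fun ⟨Z, a, b, c⟩ => ⟨Z, b, a, c⟩⟩

theorem stmt5 :
    ∃ C : ℝ, 0 < C ∧
      ∀ α : ℝ, 0 < α → α < 1 → ∀ n : ℕ, 2 ≤ n →
        ∃ q : ℕ, (q : ℝ) ≤ C / α ^ 3 ∧
          ∀ m : ℕ, 2 * α⁻¹ ^ 2 * Real.log n < (m : ℝ) →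
            ∃ S : Fin n → List (Fin q), (∀ i, (S i).length = m) ∧
              ∀ i j : Fin n, i ≠ j → ((lcsLen (S i) (S j) : ℕ) : ℝ) ≤ α * m := by
  classical
  refine ⟨Real.exp 3 + 1, by positivity, fun α h0 h1 n hn => ⟨⌈Real.exp 3 / α ^ 2⌉₊, ?_, ?_⟩⟩
  · have := Nat.ceil_lt_add_one (a := Real.exp 3 / α ^ 2) (by positivity)
    refine this.le.trans ?_
    have h3 : α ^ 3 ≤ α ^ 2 := pow_le_pow_of_le_one h0.le h1.le (by norm_num)
    have h4 : α ^ 3 ≤ 1 := pow_le_one₀ h0.le h1.le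
    rw [add_div]
    gcongr
    rw [le_div_iff₀ (by positivity)]
    linarith
  intro m hm
  set q := ⌈Real.exp 3 / α ^ 2⌉₊ with hq
  have hq' : Real.exp 3 / α ^ 2 ≤ q := Nat.le_ceil _
  have hqpos : (0 : ℝ) < q := lt_of_lt_of_le (by positivity) hq'
  set k := ⌊α * m⌋₊ + 1 with hk
  have hk' : α * m < k := by rw [hk]; push_cast; exact Nat.lt_floor_add_one _
  have hchoose : (m.choose k : ℝ) ≤ (Real.exp 1 / α) ^ k := by
    have a1 : (m.choose k : ℝ) ≤ (m : ℝ) ^ k / k.factorial := Nat.choose_le_pow_div k m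
    have a2 : (α * m) ^ k / k.factorial ≤ Real.exp (α * m) :=
      Real.pow_div_factorial_le_exp _ (by positivity) k
    have a3 : Real.exp (α * m) ≤ Real.exp 1 ^ k := by
      rw [← Real.exp_nat_mul]; simpa using hk'.le
    rw [div_pow, le_div_iff₀ (by positivity)]
    calc (m.choose k : ℝ) * α ^ k ≤ (m : ℝ) ^ k / k.factorial * α ^ k := by gcongr
      _ = (α * m) ^ k / k.factorial := by rw [mul_pow]; ring
      _ ≤ _ := a2.trans a3
  have hnn : (n : ℝ) < Real.exp 1 ^ k := by
    have hnpos : (0 : ℝ) < n := by positivity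
    have hlog : 0 ≤ Real.log n := Real.log_natCast_nonneg n
    rw [← Real.exp_nat_mul, mul_one, ← Real.log_lt_iff_lt_exp hnpos]
    refine lt_of_le_of_lt ?_ hk'
    have : α * (2 * α⁻¹ ^ 2 * Real.log n) ≤ α * m := by gcongr
    have e : α * (2 * α⁻¹ ^ 2 * Real.log n) = 2 * α⁻¹ * Real.log n := by field_simp
    have : 1 ≤ α⁻¹ := (one_le_inv₀ h0).2 h1.le
    nlinarith
  have hmain : n * (m.choose k) ^ 2 < q ^ k := by
    have : (n : ℝ) * (m.choose k : ℝ) ^ 2 < (q : ℝ) ^ k := by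
      calc (n : ℝ) * (m.choose k : ℝ) ^ 2 ≤ n * ((Real.exp 1 / α) ^ k) ^ 2 := by gcongr
        _ < Real.exp 1 ^ k * ((Real.exp 1 / α) ^ k) ^ 2 := by gcongr
        _ = (Real.exp 3 / α ^ 2) ^ k := by
          rw [pow_right_comm, ← mul_pow]
          congr 1
          have : Real.exp 3 = Real.exp 1 ^ 3 := by rw [← Real.exp_nat_mul]; norm_num
          rw [this]; ring
        _ ≤ _ := by gcongr
    exact_mod_cast this
  have hqk : 0 < q := by exact_mod_cast hqpos
  obtain ⟨S, hS⟩ := aux_greedy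
    (fun f g : Fin m → Fin q => k ≤ lcsLen (List.ofFn f) (List.ofFn g))
    (fun f g h => by rw [aux_symm]; exact h) ((m.choose k) ^ 2 * q ^ m / q ^ k) n
    (fun f => (Nat.le_div_iff_mul_le (by positivity)).2 (aux_bad k m q f))
    (by
      simp only [Fintype.card_fun, Fintype.card_fin]
      refine lt_of_le_of_lt (Nat.mul_div_le_mul_div_assoc _ _ _) ?_
      rw [Nat.div_lt_iff_lt_mul (by positivity), ← mul_assoc, mul_comm (q ^ m)]
      exact Nat.mul_lt_mul_of_pos_right hmain (by positivity))
  refine ⟨fun i => List.ofFn (S i), by simp, fun i j hij => ?_⟩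
  have := hS i j hij
  have h2 : lcsLen (List.ofFn (S i)) (List.ofFn (S j)) ≤ ⌊α * m⌋₊ := by omega
  exact (Nat.le_floor_iff (by positivity)).1 h2
end

section
/- Assume the block setup. Let i ∈ W. (a) If σ is an alignment of L_1 into Y_i under which Z_i is 1/2-aligned with the segment S_1⋯S_{i−1} of Y_i, then there exists an integer j with 1 ≤ j ≤ i such that |C[j,i]| ≤ (2α/β)·(i−j+1). (b) If σ' is an alignment of L_1 into Y'_i under which Z_i is 1/2-aligned with the segment S_{i+1}⋯S_n of Y'_i, then there exists an integer j with i ≤ j ≤ n such that |C[i,j]| ≤ (2α/β)·(j−i+1). -/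
open scoped Classical

/-- The number of neighbours of `v_i` with smaller index, i.e. `|N_<(v_i)|`. -/
def numNbrLT {n : ℕ} (G : SimpleGraph (Fin n)) [DecidableRel G.Adj] (i : Fin n) : ℕ :=
  ((List.finRange n).filter (fun j => decide (G.Adj i j ∧ j < i))).length

/-- The block string `Y_i`. -/
def JLY {n : ℕ} {A : Type*} (G : SimpleGraph (Fin n)) [DecidableRel G.Adj]
    (S : Fin n → List A) (i : Fin n) : List A :=
  ((JLX G i).map S).flatten

/-- The block string `Y'_i`. -/
def JLY' {n : ℕ} {A : Type*} (G : SimpleGraph (Fin n)) [DecidableRel G.Adj]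
    (S : Fin n → List A) (i : Fin n) : List A :=
  ((JLX' G i).map S).flatten

/-- The string `L₁ = Z_1 Z_2 ⋯ Z_n`. -/
def L1str {n : ℕ} {A : Type*} (Z : Fin n → List A) : List A :=
  ((List.finRange n).map Z).flatten

/-- The position in `L₁` at which the piece `Z_t` starts. -/
def blockOffset {n : ℕ} {A : Type*} (Z : Fin n → List A) (t : Fin n) : ℕ :=
  ∑ s ∈ Finset.univ.filter (fun s : Fin n => s < t), (Z s).length

/-- An alignment of `L` into `Y`: a strictly increasing map on positions of `L`
under which corresponding symbols agree. -/
def IsAlignment {A : Type*} (L Y : List A) (σ : ℕ → ℕ) : Prop :=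
  (∀ p q : ℕ, p < q → q < L.length → σ p < σ q) ∧
  (∀ p : ℕ, p < L.length → σ p < Y.length) ∧
  (∀ (p : ℕ) (hp : p < L.length) (hq : σ p < Y.length), L.get ⟨p, hp⟩ = Y.get ⟨σ p, hq⟩)

/-- `Z_t` is `1/2`-aligned (under `σ`) with the segment of `Y` occupying the
positions `[lo, hi)`: all positions of the first `⌈|Z_t|/2⌉` symbols of `Z_t`, or
all positions of the last `⌈|Z_t|/2⌉` symbols of `Z_t`, are mapped into `[lo, hi)`. -/
def HalfAligned {n : ℕ} {A : Type*} (σ : ℕ → ℕ) (Z : Fin n → List A) (t : Fin n)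
    (lo hi : ℕ) : Prop :=
  (∀ p : ℕ, blockOffset Z t ≤ p → p < blockOffset Z t + ((Z t).length + 1) / 2 →
      lo ≤ σ p ∧ σ p < hi) ∨
  (∀ p : ℕ, blockOffset Z t + (Z t).length - ((Z t).length + 1) / 2 ≤ p →
      p < blockOffset Z t + (Z t).length → lo ≤ σ p ∧ σ p < hi)

/-- `σ` maps some position of `Z_j` into the positions `[lo, hi)` of the target. -/
def HitsSegment {n : ℕ} {A : Type*} (σ : ℕ → ℕ) (Z : Fin n → List A) (j : Fin n)
    (lo hi : ℕ) : Prop :=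
  ∃ p : ℕ, blockOffset Z j ≤ p ∧ p < blockOffset Z j + (Z j).length ∧
    lo ≤ σ p ∧ σ p < hi

/-- `C[i,j] = {t ∈ W : i ≤ t ≤ j}` where `W = {t : Z_t ≠ ε}`. -/
noncomputable def Cset {n : ℕ} {A : Type*} (Z : Fin n → List A) (i j : Fin n) :
    Finset (Fin n) :=
  Finset.univ.filter (fun t => Z t ≠ [] ∧ i ≤ t ∧ t ≤ j)


/-- Abstract extremal argument. -/
lemma abs_aux {ι : Type*} (W : Finset ι) (v b : ι → ℤ) (hv : Function.Injective v)
    (i : ι) (hi : i ∈ W) (hmax : ∀ t ∈ W, v t ≤ v i) (c : ℝ) (hc : 0 ≤ c)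
    (H0 : (b i : ℝ) ≤ v i - c)
    (H1 : ∀ t ∈ W, ∀ t' ∈ W, v t < v t' → b t' < v t → (b t : ℝ) ≤ b t' - c) :
    ∃ t ∈ W, c * ((W.filter (fun s => b t < v s)).card : ℝ) ≤ v i - b t := by
  have hne : (W.filter (fun t =>
      c * ((W.filter (fun s => v t ≤ v s)).card : ℝ) ≤ v i - b t)).Nonempty := by
    refine ⟨i, ?_⟩
    rw [Finset.mem_filter]
    refine ⟨hi, ?_⟩
    have : W.filter (fun s => v i ≤ v s) = {i} := by
      ext s
      simp only [Finset.mem_filter, Finset.mem_singleton]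
      constructor
      · rintro ⟨h1, h2⟩
        exact hv (le_antisymm (hmax s h1) h2)
      · rintro rfl
        exact ⟨hi, le_rfl⟩
    rw [this]
    simp
    linarith
  obtain ⟨t, ht, htmin⟩ := Finset.exists_min_image _ v hne
  rw [Finset.mem_filter] at ht
  refine ⟨t, ht.1, ?_⟩
  by_contra hcon
  push Not at hcon
  have hne2 : (W.filter (fun s => b t < v s ∧ v s < v t)).Nonempty := by
    by_contra hemp
    rw [Finset.not_nonempty_iff_eq_empty, Finset.filter_eq_empty_iff] at hemp
    have hsub : W.filter (fun s => b t < v s) ⊆ W.filter (fun s => v t ≤ v s) := by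
      intro s hs
      rw [Finset.mem_filter] at hs ⊢
      refine ⟨hs.1, ?_⟩
      by_contra h
      exact hemp hs.1 ⟨hs.2, not_le.mp h⟩
    have h1 : ((W.filter (fun s => b t < v s)).card : ℝ)
        ≤ ((W.filter (fun s => v t ≤ v s)).card : ℝ) := by
      exact_mod_cast Finset.card_le_card hsub
    have := mul_le_mul_of_nonneg_left h1 hc
    linarith [ht.2]
  obtain ⟨s, hs, hsmax⟩ := Finset.exists_max_image _ v hne2
  rw [Finset.mem_filter] at hs
  have hb := H1 s hs.1 t ht.1 hs.2.2 hs.2.1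
  have hcard : ((W.filter (fun r => v s ≤ v r)).card : ℝ)
      ≤ ((W.filter (fun r => v t ≤ v r)).card : ℝ) + 1 := by
    have : W.filter (fun r => v s ≤ v r) ⊆ insert s (W.filter (fun r => v t ≤ v r)) := by
      intro r hr
      rw [Finset.mem_filter] at hr
      rw [Finset.mem_insert, Finset.mem_filter]
      by_cases h : v t ≤ v r
      · exact Or.inr ⟨hr.1, h⟩
      · left
        push Not at h
        have := hsmax r (by
          rw [Finset.mem_filter]
          exact ⟨hr.1, lt_of_lt_of_le hs.2.1 hr.2, h⟩)
        exact hv (le_antisymm this hr.2)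
    have h2 := (Finset.card_le_card this).trans (Finset.card_insert_le _ _)
    exact_mod_cast h2
  have hP : s ∈ W.filter (fun t =>
      c * ((W.filter (fun s => v t ≤ v s)).card : ℝ) ≤ v i - b t) := by
    rw [Finset.mem_filter]
    refine ⟨hs.1, ?_⟩
    have := mul_le_mul_of_nonneg_left hcard hc
    linarith [ht.2]
  have := htmin s hP
  omega

lemma card_le_lcsLen {A : Type*} (S T : List A) (F : Finset ℕ) (f g : ℕ → ℕ)
    (hf : ∀ p ∈ F, ∀ q ∈ F, p < q → f p < f q)
    (hg : ∀ p ∈ F, ∀ q ∈ F, p < q → g p < g q)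
    (hfl : ∀ p ∈ F, f p < S.length)
    (hfg : ∀ p ∈ F, S[f p]? = T[g p]?) : F.card ≤ lcsLen S T := by
  have hgl : ∀ p ∈ F, g p < T.length := by
    intro p hp
    have h := hfg p hp
    rw [List.getElem?_eq_getElem (hfl p hp)] at h
    exact (List.getElem?_eq_some_iff.mp h.symm).1
  set e := F.orderEmbOfFin rfl with he
  have hem : ∀ r, e r ∈ F := fun r => Finset.orderEmbOfFin_mem F rfl r
  let Z : List A := List.ofFn (fun r : Fin F.card => S[f (e r)]'(hfl _ (hem r)))
  have hZl : Z.length = F.card := by simp [Z]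
  unfold lcsLen
  apply le_csSup
  · refine ⟨S.length, ?_⟩
    rintro k ⟨Z, h, _, rfl⟩
    exact h.length_le
  · refine ⟨Z, ?_, ?_, hZl⟩
    · rw [List.sublist_iff_exists_fin_orderEmbedding_get_eq]
      refine ⟨OrderEmbedding.ofStrictMono
        (fun r => ⟨f (e (Fin.cast hZl r)), hfl _ (hem _)⟩) ?_, ?_⟩
      · intro a b hab
        exact hf _ (hem _) _ (hem _) (e.strictMono (by simpa using hab))
      · intro r
        simp [Z]
        rfl
    · rw [List.sublist_iff_exists_fin_orderEmbedding_get_eq]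
      refine ⟨OrderEmbedding.ofStrictMono
        (fun r => ⟨g (e (Fin.cast hZl r)), hgl _ (hem _)⟩) ?_, ?_⟩
      · intro a b hab
        exact hg _ (hem _) _ (hem _) (e.strictMono (by simpa using hab))
      · intro r
        have h := hfg _ (hem (Fin.cast hZl r))
        rw [List.getElem?_eq_getElem (hfl _ (hem _)),
          List.getElem?_eq_getElem (hgl _ (hem _))] at h
        have h' := Option.some.inj h
        simp [Z]
        exact h'

lemma flatten_getElem?_aux {A : Type*} (l : List (List A)) (k r : ℕ) (hk : k < l.length)
    (hr : r < l[k].length) :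
    l.flatten[((l.take k).map List.length).sum + r]? = l[k][r]? := by
  induction l generalizing k with
  | nil => simp at hk
  | cons a l ih =>
    cases k with
    | zero =>
      simp at hr ⊢
      rw [List.getElem?_append_left hr]
    | succ k =>
      simp only [List.flatten_cons, List.take_succ_cons, List.map_cons, List.sum_cons,
        List.getElem_cons_succ] at hr ⊢
      rw [List.getElem?_append_right (by omega)]
      rw [← ih k (by simpa using hk) hr]
      congr 1
      omega

lemma Y_getElem? {A : Type*} {n m : ℕ} (S : Fin n → List A) (hS : ∀ j, (S j).length = m)
    (X : List (Fin n)) (k r : ℕ) (hk : k < X.length) (hr : r < m) :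
    ((X.map S).flatten)[k * m + r]? = (S X[k])[r]? := by
  have h := flatten_getElem?_aux (X.map S) k r (by simpa using hk) (by simpa [hS] using hr)
  have h2 : (((X.map S).take k).map List.length).sum = k * m := by
    rw [← List.map_take, List.map_map]
    have : (List.length ∘ S) = fun _ => m := by
      funext j
      exact hS j
    rw [this]
    simp
    left
    omega
  rw [h2] at h
  simpa using h

lemma Y_length {A : Type*} {n m : ℕ} (S : Fin n → List A) (hS : ∀ j, (S j).length = m)
    (X : List (Fin n)) : ((X.map S).flatten).length = X.length * m := by
  rw [List.length_flatten, List.map_map]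
  have : (List.length ∘ S) = fun _ => m := by
    funext j
    exact hS j
  rw [this]
  simp

lemma blockOffset_eq {A : Type*} {n : ℕ} (Z : Fin n → List A) (t : Fin n) :
    blockOffset Z t = (((((List.finRange n).map Z)).take t.val).map List.length).sum := by
  unfold blockOffset
  rw [← List.map_take, List.map_map]
  have hnd : ((List.finRange n).take t.val).Nodup :=
    (List.nodup_finRange n).sublist (List.take_sublist _ _)
  rw [← List.sum_toFinset _ hnd]
  apply Finset.sum_congr _ (fun _ _ => rfl)
  ext s
  simp only [Finset.mem_filter, Finset.mem_univ, true_and, List.mem_toFinset]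
  rw [List.mem_take_iff_getElem]
  constructor
  · intro h
    exact ⟨s.val, by simp; exact h, by simp⟩
  · rintro ⟨k, hk, rfl⟩
    simp at hk
    simp [Fin.lt_def]
    omega

lemma L1_getElem? {A : Type*} {n : ℕ} (Z : Fin n → List A) (t : Fin n) (r : ℕ)
    (hr : r < (Z t).length) : (L1str Z)[blockOffset Z t + r]? = (Z t)[r]? := by
  have h := flatten_getElem?_aux ((List.finRange n).map Z) t.val r (by simp) (by simpa using hr)
  rw [← blockOffset_eq] at h
  simpa [L1str] using h

lemma lt_L1_length {A : Type*} {n : ℕ} (Z : Fin n → List A) (t : Fin n) (p : ℕ)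
    (hp : p < blockOffset Z t + (Z t).length) : p < (L1str Z).length := by
  by_cases h : (Z t).length = 0
  · have h' : blockOffset Z t ≤ (L1str Z).length := by
      rw [blockOffset_eq, ← List.length_flatten, L1str]
      apply List.Sublist.length_le
      exact (List.take_sublist _ _).flatten
    omega
  · have h1 := L1_getElem? Z t ((Z t).length - 1) (by omega)
    rw [List.getElem?_eq_getElem (show (Z t).length - 1 < (Z t).length by omega)] at h1
    have := (List.getElem?_eq_some_iff.mp h1).1
    omega

lemma blockOffset_add_le {A : Type*} {n : ℕ} (Z : Fin n → List A) (t t' : Fin n) (h : t < t') :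
    blockOffset Z t + (Z t).length ≤ blockOffset Z t' := by
  unfold blockOffset
  rw [add_comm, ← Finset.sum_insert (f := fun s => (Z s).length) (by simp)]
  apply Finset.sum_le_sum_of_subset
  intro s hs
  simp at hs ⊢
  rcases hs with rfl | hs
  · exact h
  · exact hs.trans h

/-- A contiguous piece of `Z_t` mapped into blocks with labels different from `t`. -/
lemma piece_bound {n m : ℕ} {A : Type*} (α : ℝ)
    (S Z : Fin n → List A) (hSlen : ∀ j, (S j).length = m)
    (hLCS : ∀ i j : Fin n, i ≠ j → ((lcsLen (S i) (S j) : ℕ) : ℝ) ≤ α * m)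
    (hsub : ∀ t, (Z t).Sublist (S t)) (hm : 0 < m) (hα0 : 0 ≤ α)
    (X : List (Fin n)) (σ : ℕ → ℕ) (hσ : IsAlignment (L1str Z) ((X.map S).flatten) σ)
    (t : Fin n) (P Q u v : ℕ) (hP : blockOffset Z t ≤ P)
    (hQ : Q ≤ blockOffset Z t + (Z t).length) (hPQ : P < Q)
    (hu : u ≤ σ P / m) (hv : σ (Q - 1) / m ≤ v)
    (hX : ∀ k (hk : k < X.length), u ≤ k → k ≤ v → X[k] ≠ t) :
    ((Q : ℝ) - P) ≤ ((v : ℝ) - u + 1) * (α * m) := by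
  obtain ⟨hmono, hlt, hget⟩ := hσ
  have hL : ∀ p, p < Q → p < (L1str Z).length := fun p hp => lt_L1_length Z t p (by omega)
  have hmono' : ∀ p q, p ≤ q → q < Q → σ p ≤ σ q := by
    intro p q hpq hq
    rcases hpq.eq_or_lt with rfl | h
    · exact le_rfl
    · exact (hmono p q h (hL q hq)).le
  have hmaps : ∀ p ∈ Finset.Ico P Q, σ p / m ∈ Finset.Icc u v := by
    intro p hp
    rw [Finset.mem_Ico] at hp
    rw [Finset.mem_Icc]
    exact ⟨hu.trans (Nat.div_le_div_right (hmono' P p hp.1 hp.2)),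
      (Nat.div_le_div_right (hmono' p (Q - 1) (by omega) (by omega))).trans hv⟩
  have hcard := Finset.card_eq_sum_card_fiberwise hmaps
  have hfib : ∀ k ∈ Finset.Icc u v,
      (((Finset.Ico P Q).filter (fun p => σ p / m = k)).card : ℝ) ≤ α * m := by
    intro k hk
    rw [Finset.mem_Icc] at hk
    by_cases hkX : k < X.length
    · have hne := hX k hkX hk.1 hk.2
      refine le_trans ?_ (hLCS t X[k] hne.symm)
      have hle : ((Finset.Ico P Q).filter (fun p => σ p / m = k)).card
          ≤ lcsLen (Z t) (S X[k]) := by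
        apply card_le_lcsLen _ _ _ (fun p => p - blockOffset Z t) (fun p => σ p % m)
        · intro p hp q hq hpq
          simp only [Finset.mem_filter, Finset.mem_Ico] at hp hq
          show p - _ < q - _
          omega
        · intro p hp q hq hpq
          simp only [Finset.mem_filter, Finset.mem_Ico] at hp hq
          have h1 := hmono p q hpq (hL q hq.1.2)
          have h2 := Nat.div_add_mod (σ p) m
          have h3 := Nat.div_add_mod (σ q) m
          rw [hp.2] at h2
          rw [hq.2] at h3
          show σ p % m < σ q % m
          omega
        · intro p hp
          simp only [Finset.mem_filter, Finset.mem_Ico] at hp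
          show p - _ < _
          omega
        · intro p hp
          simp only [Finset.mem_filter, Finset.mem_Ico] at hp
          have h1 := L1_getElem? Z t (p - blockOffset Z t) (by omega)
          rw [Nat.add_sub_cancel' (by omega)] at h1
          have h2 := Y_getElem? S hSlen X k (σ p % m) hkX (Nat.mod_lt _ hm)
          have h3 := Nat.div_add_mod (σ p) m
          rw [hp.2, mul_comm] at h3
          rw [h3] at h2
          show (Z t)[p - blockOffset Z t]? = (S X[k])[σ p % m]?
          rw [← h1, ← h2]
          have hp1 := hL p hp.1.2
          have hp2 := hlt p hp1
          rw [List.getElem?_eq_getElem hp1, List.getElem?_eq_getElem hp2]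
          exact congrArg some (hget p hp1 hp2)
      have hle2 : lcsLen (Z t) (S X[k]) ≤ lcsLen (S t) (S X[k]) := by
        unfold lcsLen
        apply csSup_le_csSup
        · refine ⟨(S t).length, ?_⟩
          rintro k ⟨Z, h, _, rfl⟩
          exact h.length_le
        · exact ⟨0, [], by simp, by simp, rfl⟩
        · rintro k ⟨T, h1, h2, h3⟩
          exact ⟨T, h1.trans (hsub t), h2, h3⟩
      exact_mod_cast hle.trans hle2
    · have : (Finset.Ico P Q).filter (fun p => σ p / m = k) = ∅ := by
        rw [Finset.filter_eq_empty_iff]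
        intro p hp hpk
        rw [Finset.mem_Ico] at hp
        have h1 := hlt p (hL _ hp.2)
        rw [Y_length S hSlen X] at h1
        have h2 := Nat.div_lt_of_lt_mul (show σ p < m * X.length by rw [mul_comm]; exact h1)
        omega
      rw [this]
      simp
      positivity
  have h1 : (((Finset.Ico P Q).card : ℕ) : ℝ) ≤ ∑ k ∈ Finset.Icc u v, α * (m : ℝ) := by
    rw [hcard]
    push_cast
    exact Finset.sum_le_sum hfib
  have huv : u ≤ v := by
    have := hmaps P (by rw [Finset.mem_Ico]; omega)
    rw [Finset.mem_Icc] at this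
    omega
  rw [Finset.sum_const, Nat.card_Ico, Nat.card_Icc, nsmul_eq_mul, Nat.cast_sub hPQ.le,
    Nat.cast_sub (by omega)] at h1
  push_cast at h1
  linarith

lemma filter_ne_eq {n : ℕ} (i : Fin n) :
    (List.finRange n).filter (fun j => decide (j ≠ i)) = (List.finRange n).eraseIdx i.val := by
  have h := (List.nodup_finRange n).erase_eq_filter i
  rw [List.erase_eq_eraseIdx_of_idxOf (i := i.val) (by simp)] at h
  rw [h]
  apply List.filter_congr
  intro x _
  by_cases hx : x = i <;> simp [hx]

lemma JLX_get {n : ℕ} (G : SimpleGraph (Fin n)) [DecidableRel G.Adj] (i : Fin n) (k : ℕ)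
    (hk : k < (JLX G i).length) (hki : k < i.val) : ((JLX G i)[k]).val = k := by
  have h : (JLX G i)[k]? = some ⟨k, by omega⟩ := by
    unfold JLX
    rw [filter_ne_eq, List.append_assoc, List.getElem?_append_left (by
      rw [List.length_eraseIdx]; simp; omega)]
    rw [List.getElem?_eraseIdx]
    rw [if_pos hki, List.getElem?_eq_getElem (by simp; omega)]
    simp
  rw [List.getElem?_eq_getElem hk] at h
  rw [Option.some.inj h]

lemma JLX'_get {n : ℕ} (G : SimpleGraph (Fin n)) [DecidableRel G.Adj] (i : Fin n) (k : ℕ)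
    (hk : k < (JLX' G i).length) (hki : numNbrLT G i + 1 + i.val ≤ k) :
    ((JLX' G i)[k]).val + numNbrLT G i = k := by
  have hlen : ((List.finRange n).filter (fun j => decide (G.Adj i j ∧ j < i)) ++ [i]).length
      = numNbrLT G i + 1 := by simp [numNbrLT]
  have hk2 : k < numNbrLT G i + n := by
    have : (JLX' G i).length = numNbrLT G i + 1 + (n - 1) := by
      unfold JLX'
      rw [filter_ne_eq, List.length_append, hlen, List.length_eraseIdx]
      simp
    have := i.isLt
    omega
  have h : (JLX' G i)[k]? = some ⟨k - numNbrLT G i, by omega⟩ := by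
    unfold JLX'
    rw [filter_ne_eq, List.getElem?_append_right (by omega), hlen]
    rw [List.getElem?_eraseIdx, if_neg (by omega)]
    rw [show k - (numNbrLT G i + 1) + 1 = k - numNbrLT G i by omega]
    rw [List.getElem?_eq_getElem (by simp; omega)]
    simp
  rw [List.getElem?_eq_getElem hk] at h
  rw [Option.some.inj h]
  show k - numNbrLT G i + numNbrLT G i = k
  omega

lemma JLX'_length {n : ℕ} (G : SimpleGraph (Fin n)) [DecidableRel G.Adj] (i : Fin n) :
    (JLX' G i).length = numNbrLT G i + n := by
  have hlen : ((List.finRange n).filter (fun j => decide (G.Adj i j ∧ j < i)) ++ [i]).length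
      = numNbrLT G i + 1 := by simp [numNbrLT]
  unfold JLX'
  rw [filter_ne_eq, List.length_append, hlen, List.length_eraseIdx]
  have := i.isLt
  simp
  omega

/-- Choice of pieces: half of `Z_i`, all of the other `Z_t`. -/
lemma pieces {n : ℕ} {A : Type*} (σ : ℕ → ℕ) (Z : Fin n → List A) (i : Fin n) (lo hi : ℕ)
    (h : HalfAligned σ Z i lo hi) :
    ∃ P Q : Fin n → ℕ, (∀ t, blockOffset Z t ≤ P t) ∧
      (∀ t, Q t ≤ blockOffset Z t + (Z t).length) ∧
      (∀ t, Z t ≠ [] → P t < Q t) ∧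
      (∀ t, t ≠ i → Q t = P t + (Z t).length) ∧
      ((Z i).length ≤ 2 * (Q i - P i)) ∧
      (∀ p, P i ≤ p → p < Q i → lo ≤ σ p ∧ σ p < hi) := by
  have key : ∃ p q : ℕ, blockOffset Z i ≤ p ∧ q ≤ blockOffset Z i + (Z i).length ∧
      q = p + ((Z i).length + 1) / 2 ∧ (∀ r, p ≤ r → r < q → lo ≤ σ r ∧ σ r < hi) := by
    rcases h with h | h
    · exact ⟨_, _, le_rfl, by omega, rfl, h⟩
    · exact ⟨_, _, by omega, le_rfl, by omega, h⟩
  obtain ⟨p, q, h1, h2, h3, h4⟩ := key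
  have hpos : ∀ t, Z t ≠ [] → 0 < (Z t).length := fun t ht => List.length_pos_iff.mpr ht
  refine ⟨fun t => if t = i then p else blockOffset Z t,
    fun t => if t = i then q else blockOffset Z t + (Z t).length, ?_, ?_, ?_, ?_, ?_, ?_⟩
  · intro t
    by_cases ht : t = i
    · subst ht; simpa using h1
    · simp [ht]
  · intro t
    by_cases ht : t = i
    · subst ht; simpa using h2
    · simp [ht]
  · intro t hZ
    have := hpos t hZ
    by_cases ht : t = i
    · subst ht; simp; omega
    · simp [ht]; omega
  · intro t ht
    simp [ht]
  · simp; omega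
  · simpa using h4

/-- Claim 1 (sparse case): (a) if `Z_i` is 1/2-aligned with the segment
`S_1⋯S_{i−1}` of `Y_i`, there is `j ≤ i` with `|C[j,i]| ≤ (2α/β)(i−j+1)`;
(b) if `Z_i` is 1/2-aligned with the segment `S_{i+1}⋯S_n` of `Y'_i`, there is
`j ≥ i` with `|C[i,j]| ≤ (2α/β)(j−i+1)`. -/
theorem stmt8 {n m : ℕ} {A : Type*} (α β : ℝ)
    (hα0 : 0 < α) (hα : α < 1 / 8) (hβ : β = Real.sqrt (8 * α))
    (G : SimpleGraph (Fin n)) [DecidableRel G.Adj]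
    (S Z : Fin n → List A) (hSlen : ∀ j, (S j).length = m)
    (hLCS : ∀ i j : Fin n, i ≠ j → ((lcsLen (S i) (S j) : ℕ) : ℝ) ≤ α * m)
    (hsub : ∀ t, (Z t).Sublist (S t))
    (hZlen : ∀ t, Z t ≠ [] → β * m ≤ ((Z t).length : ℝ))
    (i : Fin n) (hi : Z i ≠ []) :
    (∀ σ : ℕ → ℕ, IsAlignment (L1str Z) (JLY G S i) σ →
      HalfAligned σ Z i 0 (i.val * m) →
      ∃ j : Fin n, j ≤ i ∧
        ((Cset Z j i).card : ℝ) ≤ (2 * α / β) * ((i.val : ℝ) - j.val + 1)) ∧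
    (∀ σ' : ℕ → ℕ, IsAlignment (L1str Z) (JLY' G S i) σ' →
      HalfAligned σ' Z i ((numNbrLT G i + 1 + i.val) * m) (JLY' G S i).length →
      ∃ j : Fin n, i ≤ j ∧
        ((Cset Z i j).card : ℝ) ≤ (2 * α / β) * ((j.val : ℝ) - i.val + 1)) := by
  have hlen : 0 < (Z i).length := List.length_pos_iff.mpr hi
  have hm : 0 < m := by
    have := (hsub i).length_le
    rw [hSlen] at this
    omega
  have hmR : (0 : ℝ) < m := by exact_mod_cast hm
  have hβ0 : 0 < β := by rw [hβ]; exact Real.sqrt_pos.mpr (by linarith)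
  have hβ2 : β * β = 8 * α := by rw [hβ]; exact Real.mul_self_sqrt (by linarith)
  have hβ1 : β < 1 := by nlinarith
  set c : ℝ := 4 / β with hc
  have hcβ : c * β = 4 := by rw [hc]; field_simp
  have hc0 : 0 < c := by rw [hc]; positivity
  have hc4 : 4 < c := by nlinarith
  have hcoef : 2 * α / β = 1 / c := by
    rw [hc]; field_simp; linarith
  -- arithmetic facts
  have hfull : ∀ x : ℝ, β * m ≤ x * (α * m) → 2 * c ≤ x := by
    intro x hx
    have h1 : β * m ≤ (x * α) * m := by linarith
    have h2 := le_of_mul_le_mul_right h1 hmR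
    have h3 : β * 8 ≤ β * (x * β) := by nlinarith
    have h4 := le_of_mul_le_mul_left h3 hβ0
    have h5 : (2 * c) * β ≤ x * β := by linarith
    exact le_of_mul_le_mul_right h5 hβ0
  have hfin : ∀ a x : ℝ, c * a ≤ x → a ≤ (2 * α / β) * x := by
    intro a x h
    rw [hcoef, one_div, ← div_eq_inv_mul, le_div_iff₀ hc0]
    linarith
  constructor
  · intro σ hσ hhalf
    obtain ⟨P, Q, hP, hQ, hPQ, hfl, hhf, hseg⟩ := pieces σ Z i _ _ hhalf
    have hpb := piece_bound α S Z hSlen hLCS hsub hm hα0.le (JLX G i) σ hσ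
    obtain ⟨d, hd⟩ : ∃ d : ℕ → ℕ, ∀ p, d p = σ p / m := ⟨_, fun _ => rfl⟩
    simp only [← hd] at hpb
    have hQP : ∀ t t', t < t' → Q t ≤ P t' := fun t t' h =>
      (hQ t).trans ((blockOffset_add_le Z t t' h).trans (hP t'))
    have hltL : ∀ t p, p < Q t → p < (L1str Z).length := fun t p hp =>
      lt_L1_length Z t p (lt_of_lt_of_le hp (hQ t))
    have hmem : ∀ t, Z t ≠ [] → t ≤ i → d (P t) < i.val := by
      intro t ht hti
      have h0 : σ (P t) ≤ σ (P i) := by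
        rcases hti.eq_or_lt with rfl | h
        · exact le_rfl
        · have := hQP t i h
          have := hPQ t ht
          exact (hσ.1 (P t) (P i) (by omega) (hltL i _ (hPQ i hi))).le
      have h1 := (hseg (P i) le_rfl (hPQ i hi)).2
      rw [hd]
      exact Nat.div_lt_of_lt_mul (by rw [mul_comm]; omega)
    obtain ⟨t, ht, hcard⟩ := abs_aux
      (Finset.univ.filter (fun t => Z t ≠ [] ∧ t ≤ i)) (fun t => (t.val : ℤ))
      (fun t => ((d (P t) : ℕ) : ℤ))
      (by intro a b hab; exact Fin.ext (by simpa using hab)) i (by simp [hi])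
      (by intro t ht; simp at ht ⊢; exact ht.2) c hc0.le
      (by
        have h1 := hPQ i hi
        have h2 := hseg (Q i - 1) (by omega) (by omega)
        have h3 : d (Q i - 1) < i.val := by
          rw [hd]
          exact Nat.div_lt_of_lt_mul (by rw [mul_comm]; exact h2.2)
        have h := hpb i (P i) (Q i) (d (P i)) (i.val - 1) (hP i) (hQ i) h1 le_rfl (by omega)
          (by
            intro k hk _ hk2 heq
            have := JLX_get G i k hk (by omega)
            rw [heq] at this
            omega)
        have h4 := hZlen i hi
        have h5 : ((Z i).length : ℝ) ≤ 2 * ((Q i : ℝ) - P i) := by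
          rw [← Nat.cast_sub h1.le]; exact_mod_cast hhf
        rw [Nat.cast_sub (by omega)] at h
        have h6 := hfull (2 * ((i.val : ℝ) - (1 : ℕ) - (d (P i) : ℕ) + 1)) (by linarith)
        push_cast at h6 ⊢
        linarith)
      (by
        intro t ht t' ht' htt' hb
        simp only [Finset.mem_filter, Finset.mem_univ, true_and] at ht ht'
        have htt : t < t' := by
          rw [Fin.lt_def]; exact_mod_cast htt'
        have hb' : d (P t') < t.val := by exact_mod_cast hb
        have h1 := hPQ t ht.1
        have hne : t ≠ i := ne_of_lt (lt_of_lt_of_le htt ht'.2)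
        have h2 := hQP t t' htt
        have h3 : σ (Q t - 1) ≤ σ (P t') :=
          (hσ.1 _ _ (by omega) (hltL t' _ (hPQ t' ht'.1))).le
        have hlt := hmem t' ht'.1 ht'.2
        have h := hpb t (P t) (Q t) (d (P t)) (d (P t')) (hP t) (hQ t) h1 le_rfl
          (by rw [hd, hd]; exact Nat.div_le_div_right h3)
          (by
            intro k hk _ hk2 heq
            have := JLX_get G i k hk (by omega)
            rw [heq] at this
            omega)
        have h4 := hZlen t ht.1
        have hq : (Q t : ℝ) = P t + (Z t).length := by rw [hfl t hne]; push_cast; ring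
        have h' := (show ((Z t).length : ℝ) = Q t - P t by linarith).le.trans h
        have h6 := hfull _ (h4.trans h')
        push_cast
        linarith)
    simp only [Finset.mem_filter, Finset.mem_univ, true_and] at ht
    have hlt := hmem t ht.1 ht.2
    have hin := i.isLt
    refine ⟨⟨d (P t) + 1, by omega⟩, by rw [Fin.le_def]; exact hlt, ?_⟩
    apply hfin
    refine le_trans (mul_le_mul_of_nonneg_left ?_ hc0.le) (hcard.trans (le_of_eq ?_))
    · have : (Cset Z ⟨d (P t) + 1, by omega⟩ i) ⊆
          Finset.filter (fun s : Fin n => ((d (P t) : ℕ) : ℤ) < (s.val : ℤ))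
            (Finset.univ.filter (fun t => Z t ≠ [] ∧ t ≤ i)) := by
        intro s hs
        simp only [Cset, Finset.mem_filter, Finset.mem_univ, true_and, Fin.le_def] at hs ⊢
        refine ⟨⟨hs.1, hs.2.2⟩, ?_⟩
        have := hs.2.1
        omega
      exact_mod_cast Finset.card_le_card this
    · push_cast
      ring
  · intro σ hσ hhalf
    obtain ⟨P, Q, hP, hQ, hPQ, hfl, hhf, hseg⟩ := pieces σ Z i _ _ hhalf
    have hpb := piece_bound α S Z hSlen hLCS hsub hm hα0.le (JLX' G i) σ hσ
    obtain ⟨d, hd⟩ : ∃ d : ℕ → ℕ, ∀ p, d p = σ p / m := ⟨_, fun _ => rfl⟩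
    simp only [← hd] at hpb
    set N := numNbrLT G i with hN
    have hYl : (JLY' G S i).length = (N + n) * m := by
      unfold JLY'
      rw [Y_length S hSlen, JLX'_length]
    have hQP : ∀ t t', t < t' → Q t ≤ P t' := fun t t' h =>
      (hQ t).trans ((blockOffset_add_le Z t t' h).trans (hP t'))
    have hltL : ∀ t p, p < Q t → p < (L1str Z).length := fun t p hp =>
      lt_L1_length Z t p (lt_of_lt_of_le hp (hQ t))
    have hup : ∀ t, Z t ≠ [] → d (Q t - 1) < N + n := by
      intro t ht
      have h1 := hPQ t ht
      have h2 := hσ.2.1 (Q t - 1) (hltL t _ (by omega))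
      rw [hYl] at h2
      rw [hd]
      exact Nat.div_lt_of_lt_mul (by rw [mul_comm]; exact h2)
    have hmem : ∀ t, Z t ≠ [] → i ≤ t → N + 1 + i.val ≤ d (Q t - 1) := by
      intro t ht hti
      have hpi := hPQ i hi
      have hpt := hPQ t ht
      have h0 : σ (Q i - 1) ≤ σ (Q t - 1) := by
        rcases hti.eq_or_lt with rfl | h
        · exact le_rfl
        · have := hQP i t h
          exact (hσ.1 (Q i - 1) (Q t - 1) (by omega) (hltL t _ (by omega))).le
      have h1 := (hseg (Q i - 1) (by omega) (by omega)).1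
      rw [hd, Nat.le_div_iff_mul_le hm]
      omega
    obtain ⟨t, ht, hcard⟩ := abs_aux
      (Finset.univ.filter (fun t => Z t ≠ [] ∧ i ≤ t)) (fun t => -(t.val : ℤ))
      (fun t => (N : ℤ) - ((d (Q t - 1) : ℕ) : ℤ))
      (by intro a b hab; exact Fin.ext (by simpa using hab)) i (by simp [hi])
      (by intro t ht; simp at ht ⊢; exact ht.2) c hc0.le
      (by
        have h1 := hPQ i hi
        have h2 := hseg (P i) le_rfl h1
        have h3 : N + 1 + i.val ≤ d (P i) := by
          rw [hd, Nat.le_div_iff_mul_le hm]; exact h2.1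
        have h := hpb i (P i) (Q i) (N + 1 + i.val) (d (Q i - 1)) (hP i) (hQ i) h1 h3 le_rfl
          (by
            intro k hk hk2 _ heq
            have := JLX'_get G i k hk (by omega)
            rw [heq] at this
            omega)
        have h4 := hZlen i hi
        have h5 : ((Z i).length : ℝ) ≤ 2 * ((Q i : ℝ) - P i) := by
          rw [← Nat.cast_sub h1.le]; exact_mod_cast hhf
        have h6 := hfull (2 * (((d (Q i - 1) : ℕ) : ℝ) - (N + 1 + i.val : ℕ) + 1))
          (by linarith)
        push_cast at h6 ⊢
        linarith)
      (by
        intro t ht t' ht' htt' hb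
        simp only [Finset.mem_filter, Finset.mem_univ, true_and] at ht ht'
        have htt : t' < t := by
          rw [Fin.lt_def]; omega
        have hb' : N + t.val < d (Q t' - 1) := by
          omega
        have h1 := hPQ t ht.1
        have h1' := hPQ t' ht'.1
        have hne : t ≠ i := ne_of_gt (lt_of_le_of_lt ht'.2 htt)
        have h2 := hQP t' t htt
        have h3 : σ (Q t' - 1) ≤ σ (P t) :=
          (hσ.1 _ _ (by omega) (hltL t _ h1)).le
        have hlt := hmem t' ht'.1 ht'.2
        have h := hpb t (P t) (Q t) (d (Q t' - 1)) (d (Q t - 1)) (hP t) (hQ t) h1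
          (by rw [hd, hd]; exact Nat.div_le_div_right h3) le_rfl
          (by
            intro k hk hk2 _ heq
            have := JLX'_get G i k hk (by omega)
            rw [heq] at this
            omega)
        have h4 := hZlen t ht.1
        have hq : (Q t : ℝ) = P t + (Z t).length := by rw [hfl t hne]; push_cast; ring
        have h' := (show ((Z t).length : ℝ) = Q t - P t by linarith).le.trans h
        have h6 := hfull _ (h4.trans h')
        push_cast
        linarith)
    simp only [Finset.mem_filter, Finset.mem_univ, true_and] at ht
    have hlt := hmem t ht.1 ht.2
    have hlt2 := hup t ht.1
    refine ⟨⟨d (Q t - 1) - N - 1, by omega⟩, by rw [Fin.le_def]; simp only; omega, ?_⟩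
    apply hfin
    refine le_trans (mul_le_mul_of_nonneg_left ?_ hc0.le) (hcard.trans (le_of_eq ?_))
    · have : (Cset Z i ⟨d (Q t - 1) - N - 1, by omega⟩) ⊆
          Finset.filter (fun s : Fin n => (N : ℤ) - ((d (Q t - 1) : ℕ) : ℤ) < -(s.val : ℤ))
            (Finset.univ.filter (fun t => Z t ≠ [] ∧ i ≤ t)) := by
        intro s hs
        simp only [Cset, Finset.mem_filter, Finset.mem_univ, true_and, Fin.le_def] at hs ⊢
        refine ⟨⟨hs.1, hs.2.1⟩, ?_⟩
        have := hs.2.2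
        omega
      exact_mod_cast Finset.card_le_card this
    · simp only
      rw [Nat.cast_sub (by omega), Nat.cast_sub (by omega)]
      push_cast
      ring
end

section
/- Assume the block setup. Let i ∈ W, and let σ' be an alignment of L_1 into Y'_i under which Z_i is 1/2-aligned with the segment S_{i_p}⋯S_{i_q} S_i S_1⋯S_{i−1} of Y'_i, and suppose there is no j ∈ W with j < i such that σ' maps some position of Z_j to a position inside the block S_j lying within the segment S_1⋯S_{i−1} of Y'_i. Let W^{<i} = {t ∈ W : t < i}. Then |{t ∈ W^{<i} : v_t ∈ N_<(v_i)}| + (β/(2α))·|{t ∈ W^{<i} : v_t ∉ N_<(v_i)}| ≤ 2i−1. -/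
open scoped Classical

theorem aux_sublist_of_emb {A : Type*} {c : ℕ} (f : Fin c → A) (T : List A) (τ : Fin c → ℕ)
    (hτ : StrictMono τ) (h : ∀ x, T[τ x]? = some (f x)) : (List.ofFn f).Sublist T := by
  rw [List.sublist_iff_exists_fin_orderEmbedding_get_eq]
  have hlt : ∀ x, τ x < T.length := fun x => (List.getElem?_eq_some_iff.1 (h x)).1
  refine ⟨OrderEmbedding.ofStrictMono
    (fun x => (⟨τ (Fin.cast (by simp) x), hlt _⟩ : Fin T.length)) ?_, ?_⟩
  · intro x y hxy
    exact hτ (by simpa using hxy)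
  · intro x
    have h1 := (List.getElem?_eq_some_iff.1 (h (Fin.cast (by simp) x))).2
    rw [List.get_ofFn]
    exact h1.symm

theorem aux_lcs_s11 {A : Type*} (Z S U : List A) (hZS : Z.Sublist S) (F : Finset ℕ) (τ : ℕ → ℕ)
    (hmono : ∀ p ∈ F, ∀ q ∈ F, p < q → τ p < τ q)
    (hlt : ∀ p ∈ F, p < Z.length)
    (heq : ∀ p ∈ F, U[τ p]? = Z[p]?) : F.card ≤ lcsLen S U := by
  have hmem : ∀ x, F.orderEmbOfFin rfl x ∈ F := fun x => F.orderEmbOfFin_mem rfl x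
  let f : Fin F.card → A := fun x => Z[F.orderEmbOfFin rfl x]'(hlt _ (hmem x))
  have h1 : (List.ofFn f).Sublist Z := by
    refine aux_sublist_of_emb f Z (fun x => F.orderEmbOfFin rfl x) ?_ ?_
    · exact (F.orderEmbOfFin rfl).strictMono
    · intro x
      simp [f, hlt _ (hmem x)]
  have h2 : (List.ofFn f).Sublist U := by
    refine aux_sublist_of_emb f U (fun x => τ (F.orderEmbOfFin rfl x)) ?_ ?_
    · intro x y hxy
      exact hmono _ (hmem x) _ (hmem y) ((F.orderEmbOfFin rfl).strictMono hxy)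
    · intro x
      rw [heq _ (hmem x)]
      simp [f, hlt _ (hmem x)]
  unfold lcsLen
  refine le_csSup ⟨S.length, ?_⟩ ⟨List.ofFn f, h1.trans hZS, h2, by simp⟩
  rintro k ⟨Y, hY, -, rfl⟩
  exact hY.length_le

theorem aux_flatten {ι A : Type*} (S : ι → List A) (m : ℕ) (hm : 0 < m)
    (hS : ∀ j, (S j).length = m) (l : List ι) (q : ℕ) (hq : q < (l.map S).flatten.length) :
    ∃ j, l[q / m]? = some j ∧ (l.map S).flatten[q]? = (S j)[q % m]? := by
  induction l generalizing q with
  | nil => simp at hq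
  | cons x l ih =>
    by_cases h : q < m
    · refine ⟨x, ?_, ?_⟩
      · simp [Nat.div_eq_of_lt h]
      · rw [Nat.mod_eq_of_lt h, List.map_cons, List.flatten_cons,
          List.getElem?_append_left (by rw [hS]; exact h)]
    · obtain ⟨r, rfl⟩ : ∃ r, q = r + m := ⟨q - m, by omega⟩
      rw [List.map_cons, List.flatten_cons, List.length_append, hS] at hq
      obtain ⟨j, h1, h2⟩ := ih r (by omega)
      refine ⟨j, ?_, ?_⟩
      · rw [Nat.add_div_right _ hm]
        simpa using h1
      · rw [Nat.add_mod_right, List.map_cons, List.flatten_cons,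
          List.getElem?_append_right (by rw [hS]; omega), hS, Nat.add_sub_cancel, h2]

theorem aux_offset {n : ℕ} {A : Type*} (Z : Fin n → List A) (t : Fin n) (r : ℕ)
    (hr : r < (Z t).length) :
    blockOffset Z t + r < (L1str Z).length ∧ (L1str Z)[blockOffset Z t + r]? = (Z t)[r]? := by
  have hoff : blockOffset Z t
      = ((((List.finRange n).map Z).map List.length).take t.val).sum := by
    have : ((List.finRange n).map Z).map List.length = List.ofFn (fun s => (Z s).length) := by
      simp [List.ofFn_eq_map]
    rw [this, List.sum_take_ofFn]
    unfold blockOffset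
    rfl
  have hd : (L1str Z).drop (blockOffset Z t)
      = (((List.finRange n).map Z).drop t.val).flatten := by
    rw [hoff, L1str, List.drop_sum_flatten]
  have h2 : (L1str Z)[blockOffset Z t + r]? = (Z t)[r]? := by
    rw [← List.getElem?_drop, hd, List.drop_eq_getElem_cons (by simp), List.flatten_cons,
      List.getElem?_append_left (by simpa using hr)]
    simp
  refine ⟨?_, h2⟩
  rw [List.getElem?_eq_getElem hr] at h2
  exact (List.getElem?_eq_some_iff.1 h2).1

theorem aux_offset_mono {n : ℕ} {A : Type*} (Z : Fin n → List A) (t u : Fin n) (h : t < u) :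
    blockOffset Z t + (Z t).length ≤ blockOffset Z u := by
  unfold blockOffset
  rw [add_comm, ← Finset.sum_insert (f := fun s => (Z s).length) (by simp)]
  apply Finset.sum_le_sum_of_subset
  intro s hs
  simp only [Finset.mem_insert, Finset.mem_filter, Finset.mem_univ, true_and] at hs ⊢
  rcases hs with rfl | hs
  · exact h
  · exact hs.trans h

theorem aux_nbr {n : ℕ} (G : SimpleGraph (Fin n)) [DecidableRel G.Adj] (i : Fin n) :
    numNbrLT G i ≤ i.val := by
  unfold numNbrLT
  have hnd : ((List.finRange n).filter (fun j => decide (G.Adj i j ∧ j < i))).Nodup :=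
    (List.nodup_finRange n).filter _
  rw [← List.toFinset_card_of_nodup hnd, ← Fin.card_Iio]
  apply Finset.card_le_card
  intro j hj
  simp at hj
  simpa using hj.2

theorem aux_label {n : ℕ} (G : SimpleGraph (Fin n)) [DecidableRel G.Adj] (i t : Fin n) (k : ℕ)
    (ht : t < i) (hk : k < numNbrLT G i + 1 + i.val) (h : (JLX' G i)[k]? = some t)
    (hadj : ¬ G.Adj i t) : k = numNbrLT G i + 1 + t.val := by
  unfold JLX' at h
  by_cases h1 : k < numNbrLT G i
  · rw [List.append_assoc, List.getElem?_append_left h1] at h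
    have := List.mem_of_getElem? h
    simp at this
    exact absurd this.1 hadj
  by_cases h2 : k = numNbrLT G i
  · rw [List.append_assoc, List.getElem?_append_right (by rw [h2]; rfl)] at h
    have h3 : k - ((List.finRange n).filter (fun j => decide (G.Adj i j ∧ j < i))).length = 0 := by
      rw [h2]; exact Nat.sub_self _
    rw [h3] at h
    simp at h
    exact absurd h ht.ne'
  obtain ⟨r, rfl⟩ : ∃ r, k = numNbrLT G i + 1 + r := ⟨k - (numNbrLT G i + 1), by omega⟩
  have hri : r < i.val := by omega
  rw [List.getElem?_append_right (by simp [numNbrLT])] at h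
  have h3 : numNbrLT G i + 1 + r - ((List.finRange n).filter
      (fun j => decide (G.Adj i j ∧ j < i)) ++ [i]).length = r := by
    simp [numNbrLT]
  rw [h3, ← List.take_append_drop i.val (List.finRange n), List.filter_append] at h
  have h4 : ((List.finRange n).take i.val).filter (fun j => decide (j ≠ i))
      = (List.finRange n).take i.val := by
    rw [List.filter_eq_self]
    intro a ha
    rw [List.mem_take_iff_getElem] at ha
    obtain ⟨s, hs, rfl⟩ := ha
    simp at hs ⊢
    intro hh
    have := congrArg Fin.val hh
    simp at this
    omega
  rw [h4, List.getElem?_append_left (by simp; omega)] at h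
  rw [List.getElem?_take_of_lt hri, List.getElem?_eq_some_iff] at h
  obtain ⟨_, h⟩ := h
  have := congrArg Fin.val h
  simp at this
  omega

/-- Claim 4 (dense case, backward): if `Z_i` is 1/2-aligned with the segment
`S_{N_<(v_i)} S_i S_1⋯S_{i−1}` of `Y'_i` and no `j ∈ W`, `j < i`, has a position of
`Z_j` mapped into the block `S_j` inside `S_1⋯S_{i−1}` (that block occupies positions
`[(d+1+j')m, (d+2+j')m)` of `Y'_i`, where `d = |N_<(v_i)|` and `j'` is the 0-based
index of `j`), then
`|W^{<i} ∩ N_<(v_i)| + (β/2α)·|W^{<i} \ N_<(v_i)| ≤ 2i−1`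
(with `i` 1-indexed, so `2i−1 = 2·i.val + 1`). -/
theorem stmt11 {n m : ℕ} {A : Type*} (α β : ℝ)
    (hα0 : 0 < α) (hα : α < 1 / 8) (hβ : β = Real.sqrt (8 * α))
    (G : SimpleGraph (Fin n)) [DecidableRel G.Adj]
    (S Z : Fin n → List A) (hSlen : ∀ j, (S j).length = m)
    (hLCS : ∀ i j : Fin n, i ≠ j → ((lcsLen (S i) (S j) : ℕ) : ℝ) ≤ α * m)
    (hsub : ∀ t, (Z t).Sublist (S t))
    (hZlen : ∀ t, Z t ≠ [] → β * m ≤ ((Z t).length : ℝ))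
    (i : Fin n) (hi : Z i ≠ [])
    (σ' : ℕ → ℕ) (hal : IsAlignment (L1str Z) (JLY' G S i) σ')
    (hhalf : HalfAligned σ' Z i 0 ((numNbrLT G i + 1 + i.val) * m))
    (hno : ¬ ∃ j : Fin n, j < i ∧ Z j ≠ [] ∧
        HitsSegment σ' Z j ((numNbrLT G i + 1 + j.val) * m)
          ((numNbrLT G i + 1 + j.val + 1) * m)) :
    ((Finset.univ.filter (fun t : Fin n => Z t ≠ [] ∧ t < i ∧ G.Adj i t)).card : ℝ)
      + (β / (2 * α)) *
        ((Finset.univ.filter (fun t : Fin n => Z t ≠ [] ∧ t < i ∧ ¬ G.Adj i t)).card : ℝ)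
      ≤ 2 * (i.val : ℝ) + 1 := by
  obtain ⟨hmono, hrange, heq⟩ := hal
  have hZm : ∀ t, (Z t).length ≤ m := fun t => by
    rw [← hSlen t]; exact (hsub t).length_le
  have hilen : 0 < (Z i).length := List.length_pos_iff.2 hi
  have hm : 0 < m := lt_of_lt_of_le hilen (hZm i)
  have hmR : (0 : ℝ) < m := by exact_mod_cast hm
  set D := numNbrLT G i + 1 + i.val with hD
  have hDle : D ≤ 2 * i.val + 1 := by
    have := aux_nbr G i
    omega
  have hβ8 : 8 * α ≤ β := by
    rw [hβ]
    apply Real.le_sqrt_of_sq_le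
    nlinarith
  -- some position of the piece `Z_i` is mapped into the prefix
  obtain ⟨r0, hr0, hr0D⟩ : ∃ r, r < (Z i).length ∧ σ' (blockOffset Z i + r) < D * m := by
    rcases hhalf with h | h
    · exact ⟨0, hilen, (h _ (by omega) (by omega)).2⟩
    · exact ⟨(Z i).length - 1, by omega, (h _ (by omega) (by omega)).2⟩
  let P : Fin n → ℕ → ℕ := fun t r => σ' (blockOffset Z t + r)
  have hPlt : ∀ t, ∀ r r', r < r' → r' < (Z t).length → P t r < P t r' := by
    intro t r r' h h'
    exact hmono _ _ (by omega) (aux_offset Z t r' h').1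
  have hPlt' : ∀ t u, t < u → ∀ r r', r < (Z t).length → r' < (Z u).length →
      P t r < P u r' := by
    intro t u htu r r' h h'
    have := aux_offset_mono Z t u htu
    exact hmono _ _ (by omega) (aux_offset Z u r' h').1
  have hPD : ∀ t, t < i → ∀ r, r < (Z t).length → P t r < D * m := by
    intro t ht r hr
    exact (hPlt' t i ht r r0 hr hr0).trans hr0D
  let K : Fin n → ℕ → ℕ := fun t r => P t r / m
  have hKD : ∀ t, t < i → ∀ r, r < (Z t).length → K t r < D := by
    intro t ht r hr
    exact (Nat.div_lt_iff_lt_mul hm).2 (hPD t ht r hr)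
  have hKle : ∀ t, ∀ r r', r ≤ r' → r' < (Z t).length → K t r ≤ K t r' := by
    intro t r r' h h'
    rcases h.eq_or_lt with rfl | h
    · exact le_rfl
    · exact Nat.div_le_div_right (hPlt t r r' h h').le
  have hKle' : ∀ t u, t < u → ∀ r r', r < (Z t).length → r' < (Z u).length →
      K t r ≤ K u r' := by
    intro t u htu r r' h h'
    exact Nat.div_le_div_right (hPlt' t u htu r r' h h').le
  have hlab : ∀ t r, r < (Z t).length →
      ∃ j, (JLX' G i)[K t r]? = some j ∧ (S j)[P t r % m]? = (Z t)[r]? := by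
    intro t r hr
    obtain ⟨h1, h2⟩ := aux_offset Z t r hr
    have h3 := hrange _ h1
    obtain ⟨j, h4, h5⟩ := aux_flatten S m hm hSlen (JLX' G i) (P t r) h3
    refine ⟨j, h4, ?_⟩
    rw [← h5, ← h2, List.getElem?_eq_getElem h1]
    have h6 := heq _ h1 h3
    simp only [List.get_eq_getElem] at h6
    rw [h6]
    exact List.getElem?_eq_getElem h3
  let own : Fin n → Prop := fun t => ∃ r, r < (Z t).length ∧ (JLX' G i)[K t r]? = some t
  have hown : ∀ t, t < i → Z t ≠ [] → own t → G.Adj i t := by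
    rintro t ht hZt ⟨r, hr, hrt⟩
    by_contra hadj
    have hk := aux_label G i t (K t r) ht (hKD t ht r hr) hrt hadj
    apply hno
    refine ⟨t, ht, hZt, blockOffset Z t + r, by omega, by omega, ?_, ?_⟩
    · rw [← hk]; exact Nat.div_mul_le_self _ _
    · rw [← hk, mul_comm]; exact Nat.lt_mul_div_succ _ hm
  let B : Fin n → Finset ℕ := fun t =>
    if h : own t then {K t h.choose} else Finset.Ioo (K t 0) (K t ((Z t).length - 1))
  have hBown : ∀ t, own t → ∃ r, r < (Z t).length ∧ (JLX' G i)[K t r]? = some t ∧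
      B t = {K t r} := by
    intro t h
    exact ⟨h.choose, h.choose_spec.1, h.choose_spec.2, by simp [B, h]⟩
  have hBnot : ∀ t, ¬ own t → B t = Finset.Ioo (K t 0) (K t ((Z t).length - 1)) := by
    intro t h
    simp [B, h]
  let W : Finset (Fin n) := Finset.univ.filter (fun t => Z t ≠ [] ∧ t < i)
  have hWpos : ∀ t ∈ W, t < i ∧ 0 < (Z t).length ∧ Z t ≠ [] := by
    intro t ht
    simp only [W, Finset.mem_filter, Finset.mem_univ, true_and] at ht
    exact ⟨ht.2, List.length_pos_iff.2 ht.1, ht.1⟩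
  have hdisjlt : ∀ t ∈ W, ∀ u ∈ W, t < u → Disjoint (B t) (B u) := by
    intro t ht u hu htu
    obtain ⟨hti, htl, -⟩ := hWpos t ht
    obtain ⟨hui, hul, -⟩ := hWpos u hu
    rw [Finset.disjoint_left]
    intro x hx hx'
    by_cases h1 : own t
    · obtain ⟨r, hr, hrt, hB⟩ := hBown t h1
      rw [hB, Finset.mem_singleton] at hx
      by_cases h2 : own u
      · obtain ⟨r', hr', hrt', hB'⟩ := hBown u h2
        rw [hB', Finset.mem_singleton] at hx'
        rw [← hx] at hrt
        rw [← hx', hrt] at hrt'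
        exact htu.ne (Option.some.inj hrt')
      · rw [hBnot u h2, Finset.mem_Ioo] at hx'
        have := hKle' t u htu r 0 hr hul
        omega
    · rw [hBnot t h1, Finset.mem_Ioo] at hx
      by_cases h2 : own u
      · obtain ⟨r', hr', hrt', hB'⟩ := hBown u h2
        rw [hB', Finset.mem_singleton] at hx'
        have := hKle' t u htu ((Z t).length - 1) r' (by omega) hr'
        omega
      · rw [hBnot u h2, Finset.mem_Ioo] at hx'
        have := hKle' t u htu ((Z t).length - 1) 0 (by omega) hul
        omega
  have hdisj : (W : Set (Fin n)).PairwiseDisjoint B := by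
    intro t ht u hu htu
    rcases lt_or_gt_of_ne htu with h | h
    · exact hdisjlt t ht u hu h
    · exact (hdisjlt u hu t ht h).symm
  have hsub' : W.biUnion B ⊆ Finset.range D := by
    intro x hx
    rw [Finset.mem_biUnion] at hx
    obtain ⟨t, ht, hx⟩ := hx
    obtain ⟨hti, htl, -⟩ := hWpos t ht
    rw [Finset.mem_range]
    by_cases h1 : own t
    · obtain ⟨r, hr, hrt, hB⟩ := hBown t h1
      rw [hB, Finset.mem_singleton] at hx
      rw [hx]; exact hKD t hti r hr
    · rw [hBnot t h1, Finset.mem_Ioo] at hx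
      exact hx.2.trans (hKD t hti _ (by omega))
  have hsum : ∑ t ∈ W, (B t).card ≤ D := by
    rw [← Finset.card_biUnion hdisj]
    simpa using Finset.card_le_card hsub'
  -- pieces avoiding their own block occupy many blocks
  have hcount : ∀ t ∈ W, ¬ own t → β / (2 * α) ≤ ((B t).card : ℝ) := by
    intro t ht hnot
    obtain ⟨hti, htl, htne⟩ := hWpos t ht
    let F : ℕ → Finset ℕ := fun k => (Finset.range (Z t).length).filter (fun r => K t r = k)
    have hF : ∀ k, ((F k).card : ℝ) ≤ α * m := by
      intro k
      by_cases hne : (F k).Nonempty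
      · obtain ⟨r, hr⟩ := hne
        simp only [F, Finset.mem_filter, Finset.mem_range] at hr
        obtain ⟨j, hj, -⟩ := hlab t r hr.1
        have hjt : t ≠ j := by
          rintro rfl
          exact hnot ⟨r, hr.1, hj⟩
        refine le_trans ?_ (hLCS t j hjt)
        have : (F k).card ≤ lcsLen (S t) (S j) := by
          refine aux_lcs_s11 (Z t) (S t) (S j) (hsub t) (F k) (fun s => P t s % m) ?_ ?_ ?_
          · intro p hp q hq hpq
            simp only [F, Finset.mem_filter, Finset.mem_range] at hp hq
            have h1 := hPlt t p q hpq hq.1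
            have h2 : P t p / m = P t q / m := hp.2.trans hq.2.symm
            have h3 := Nat.div_add_mod (P t p) m
            have h4 := Nat.div_add_mod (P t q) m
            rw [h2] at h3
            omega
          · intro p hp
            simp only [F, Finset.mem_filter, Finset.mem_range] at hp
            exact hp.1
          · intro p hp
            simp only [F, Finset.mem_filter, Finset.mem_range] at hp
            obtain ⟨j', hj', h5⟩ := hlab t p hp.1
            rw [hp.2, ← hr.2, hj] at hj'
            rw [Option.some.inj hj']
            exact h5
        exact_mod_cast this
      · rw [Finset.not_nonempty_iff_eq_empty] at hne
        rw [hne]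
        simp
        positivity
    have hcard : (Z t).length
        = ∑ k ∈ Finset.Icc (K t 0) (K t ((Z t).length - 1)), (F k).card := by
      conv_lhs => rw [← Finset.card_range (Z t).length]
      apply Finset.card_eq_sum_card_fiberwise
      intro r hr
      simp only [Finset.coe_range, Set.mem_Iio] at hr
      simp only [Finset.coe_Icc, Set.mem_Icc]
      exact ⟨hKle t 0 r (by omega) hr, hKle t r _ (by omega) (by omega)⟩
    have hle : ((Z t).length : ℝ)
        ≤ ((Finset.Icc (K t 0) (K t ((Z t).length - 1))).card : ℝ) * (α * m) := by
      conv_lhs => rw [hcard]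
      push_cast
      rw [← nsmul_eq_mul]
      exact Finset.sum_le_card_nsmul _ _ _ (fun k _ => hF k)
    have hBc : (Finset.Icc (K t 0) (K t ((Z t).length - 1))).card ≤ (B t).card + 2 := by
      rw [hBnot t hnot, Nat.card_Icc, Nat.card_Ioo]
      omega
    have hBcR : ((Finset.Icc (K t 0) (K t ((Z t).length - 1))).card : ℝ) ≤ (B t).card + 2 := by
      exact_mod_cast hBc
    have h1 : β * m ≤ (((B t).card : ℝ) + 2) * (α * m) :=
      (hZlen t htne).trans (hle.trans (mul_le_mul_of_nonneg_right hBcR (by positivity)))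
    have h2 : β ≤ (((B t).card : ℝ) + 2) * α := by
      rw [← mul_assoc] at h1
      exact le_of_mul_le_mul_right h1 hmR
    rw [div_le_iff₀ (by positivity)]
    nlinarith
  have hβ1 : 1 ≤ β / (2 * α) := by
    rw [le_div_iff₀ (by positivity)]
    linarith
  have hw : ∀ t ∈ W, (if G.Adj i t then (1 : ℝ) else β / (2 * α)) ≤ ((B t).card : ℝ) := by
    intro t ht
    obtain ⟨hti, htl, htne⟩ := hWpos t ht
    by_cases h1 : own t
    · rw [if_pos (hown t hti htne h1)]
      obtain ⟨r, hr, hrt, hB⟩ := hBown t h1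
      rw [hB]; simp
    · have := hcount t ht h1
      split_ifs
      · linarith
      · exact this
  have htot : ∑ t ∈ W, (if G.Adj i t then (1 : ℝ) else β / (2 * α)) ≤ 2 * (i.val : ℝ) + 1 := by
    refine (Finset.sum_le_sum hw).trans ?_
    have h3 := hsum.trans hDle
    exact_mod_cast h3
  rw [Finset.sum_ite, Finset.sum_const, Finset.sum_const, Finset.filter_filter,
    Finset.filter_filter, nsmul_eq_mul, nsmul_eq_mul, mul_one, mul_comm] at htot
  simp only [and_assoc] at htot
  convert htot using 3
end

section
/- Let α ∈ (0,1/8) and β = √(8α). Let n ∈ ℕ and W ⊆ {1,…,n}, and for 1 ≤ i ≤ j ≤ n write C[i,j] = {t ∈ W : i ≤ t ≤ j}. Define T ⊆ W as follows: for each i ∈ W for which there exists j with i < j ≤ n and |C[i,j]| ≤ (2α/β)·(j−i+1), let J(i) be the largest such j; let T be the union over all such i of the sets C[i,J(i)]. Then |W \ T| ≥ |W| − (4α/β)·n. -/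
open scoped Classical

theorem cover_aux (W : Finset ℕ) (c : ℝ) (hc : 0 ≤ c) (n : ℕ) (S : ℕ → ℕ → Prop)
    (hS : ∀ i j, S i j → j ≤ n ∧
      ((W.filter (fun u => i ≤ u ∧ u ≤ j)).card : ℝ) ≤ c * ((j : ℝ) - i + 1)) :
    ∀ (m p q : ℕ), n - p ≤ m → q ≤ p → p ≤ n → (∀ i j, S i j → p < j → q < i) →
      ((W.filter (fun t => p < t ∧ ∃ i j, S i j ∧ i ≤ t ∧ t ≤ j)).card : ℝ)
        ≤ c * ((n : ℝ) - p) + c * ((n : ℝ) - q) := by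
  intro m
  induction m with
  | zero =>
    intro p q hm hqp hpn h
    have h0 : W.filter (fun t => p < t ∧ ∃ i j, S i j ∧ i ≤ t ∧ t ≤ j) = ∅ := by
      apply Finset.filter_eq_empty_iff.2
      rintro t - ⟨hpt, i, j, hs, h1, h2⟩
      have := (hS i j hs).1
      omega
    rw [h0]
    have h1 : (p : ℝ) ≤ n := by exact_mod_cast hpn
    have h2 : (q : ℝ) ≤ p := by exact_mod_cast hqp
    have h3 := mul_nonneg hc (sub_nonneg.2 h1)
    have h4 := mul_nonneg hc (sub_nonneg.2 (h2.trans h1))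
    simp only [Finset.card_empty, Nat.cast_zero]
    linarith
  | succ m ih =>
    intro p q hm hqp hpn h
    have h1 : (p : ℝ) ≤ n := by exact_mod_cast hpn
    have h2 : (q : ℝ) ≤ p := by exact_mod_cast hqp
    by_cases hne : ∃ t, t ∈ W ∧ p < t ∧ ∃ i j, S i j ∧ i ≤ t ∧ t ≤ j
    · obtain ⟨htW, hpt, i0, j0, hs0, hi0, hj0⟩ := Nat.find_spec hne
      have hmin : ∀ s, (s ∈ W ∧ p < s ∧ ∃ i j, S i j ∧ i ≤ s ∧ s ≤ j) → Nat.find hne ≤ s :=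
        fun s hs => Nat.find_min' hne hs
      generalize Nat.find hne = t at *
      have hex : ∃ j, t ≤ j ∧ (∃ i, S i j ∧ i ≤ t) ∧
          ∀ i' j', S i' j' → i' ≤ t → j' ≤ j := by
        let P : ℕ → Prop := fun j => t ≤ j ∧ ∃ i, S i j ∧ i ≤ t
        have hP0 : P j0 := ⟨hj0, i0, hs0, hi0⟩
        have hle : j0 ≤ n := (hS _ _ hs0).1
        have hsp : P (Nat.findGreatest P n) := Nat.findGreatest_spec hle hP0
        refine ⟨Nat.findGreatest P n, hsp.1, hsp.2, ?_⟩
        intro i' j' hs hi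
        by_cases htj : t ≤ j'
        · exact Nat.le_findGreatest (hS _ _ hs).1 ⟨htj, i', hs, hi⟩
        · exact (not_le.1 htj).le.trans hsp.1
      obtain ⟨j, htj, ⟨i, hs, hit⟩, hmax⟩ := hex
      obtain ⟨hjn, hcard⟩ := hS i j hs
      have hqi := h i j hs (by omega)
      have key := ih j t (by omega) htj hjn (by
        intro i' j' hs' hj'
        by_contra hcon
        have := hmax i' j' hs' (by omega)
        omega)
      have hsub : W.filter (fun t => p < t ∧ ∃ i j, S i j ∧ i ≤ t ∧ t ≤ j) ⊆
          W.filter (fun u => i ≤ u ∧ u ≤ j) ∪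
          W.filter (fun t => j < t ∧ ∃ i j, S i j ∧ i ≤ t ∧ t ≤ j) := by
        intro s hsm
        rw [Finset.mem_filter] at hsm
        rw [Finset.mem_union, Finset.mem_filter, Finset.mem_filter]
        have := hmin s hsm
        by_cases hsj : s ≤ j
        · exact Or.inl ⟨hsm.1, by omega, hsj⟩
        · exact Or.inr ⟨hsm.1, by omega, hsm.2.2⟩
      have hc1 := (Finset.card_le_card hsub).trans (Finset.card_union_le _ _)
      have hc2 : ((W.filter (fun t => p < t ∧ ∃ i j, S i j ∧ i ≤ t ∧ t ≤ j)).card : ℝ) ≤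
          ((W.filter (fun u => i ≤ u ∧ u ≤ j)).card : ℝ) +
          ((W.filter (fun t => j < t ∧ ∃ i j, S i j ∧ i ≤ t ∧ t ≤ j)).card : ℝ) := by
        exact_mod_cast hc1
      have e1 : (q : ℝ) + 1 ≤ i := by exact_mod_cast hqi
      have e2 : (p : ℝ) ≤ t := by exact_mod_cast hpt.le
      have e3 := mul_nonneg hc (sub_nonneg.2 e1)
      have e4 := mul_nonneg hc (sub_nonneg.2 e2)
      linarith
    · have h0 : W.filter (fun t => p < t ∧ ∃ i j, S i j ∧ i ≤ t ∧ t ≤ j) = ∅ := by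
        apply Finset.filter_eq_empty_iff.2
        intro t ht hh
        exact hne ⟨t, ht, hh⟩
      rw [h0]
      have h3 := mul_nonneg hc (sub_nonneg.2 h1)
      have h4 := mul_nonneg hc (sub_nonneg.2 (h2.trans h1))
      simp only [Finset.card_empty, Nat.cast_zero]
      linarith

/-- Removing the sparse portions: `|W \ T| ≥ |W| − (4α/β)·n`.  Here
`C[i,j] = {t ∈ W : i ≤ t ≤ j}` and `T` is the union, over all `i ∈ W` admitting
some `j` with `i < j ≤ n` and `|C[i,j]| ≤ (2α/β)(j−i+1)`, of the sets `C[i,J(i)]`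
where `J(i)` is the largest such `j`; equivalently, `T` consists of those `t ∈ W`
lying in `C[i,j]` for some `i ∈ W` and some such `j`. -/
theorem stmt12 (α β : ℝ) (hα0 : 0 < α) (hα : α < 1 / 8) (hβ : β = Real.sqrt (8 * α))
    (n : ℕ) (W : Finset ℕ) (hW : ∀ t ∈ W, 1 ≤ t ∧ t ≤ n) :
    ((W \ (W.filter (fun t => ∃ i ∈ W, ∃ j : ℕ, i < j ∧ j ≤ n ∧
        ((W.filter (fun u => i ≤ u ∧ u ≤ j)).card : ℝ) ≤ (2 * α / β) * ((j : ℝ) - i + 1) ∧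
        i ≤ t ∧ t ≤ j))).card : ℝ)
      ≥ (W.card : ℝ) - (4 * α / β) * n := by
  have hc : 0 ≤ 2 * α / β := by
    rw [hβ]; positivity
  have h4 : 4 * α / β = 2 * (2 * α / β) := by ring
  rw [h4]
  generalize 2 * α / β = c at *
  have key := cover_aux W c hc n (fun i j => i ∈ W ∧ i < j ∧ j ≤ n ∧
      ((W.filter (fun u => i ≤ u ∧ u ≤ j)).card : ℝ) ≤ c * ((j : ℝ) - i + 1))
    (fun i j h => ⟨h.2.2.1, h.2.2.2⟩) n 0 0 (by omega) le_rfl (Nat.zero_le _)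
    (fun i j h _ => (hW i h.1).1)
  set T := W.filter (fun t => ∃ i ∈ W, ∃ j : ℕ, i < j ∧ j ≤ n ∧
        ((W.filter (fun u => i ≤ u ∧ u ≤ j)).card : ℝ) ≤ c * ((j : ℝ) - i + 1) ∧
        i ≤ t ∧ t ≤ j) with hT
  have hTle : (T.card : ℝ) ≤ c * ((n : ℝ) - (0 : ℕ)) + c * ((n : ℝ) - (0 : ℕ)) := by
    refine le_trans ?_ key
    rw [Nat.cast_le]
    apply Finset.card_le_card
    intro t ht
    rw [hT, Finset.mem_filter] at ht
    obtain ⟨htW, i, hi, j, h1, h2, h3, h5, h6⟩ := ht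
    rw [Finset.mem_filter]
    exact ⟨htW, (hW t htW).1, i, j, ⟨hi, h1, h2, h3⟩, h5, h6⟩
  have hTW : T ⊆ W := Finset.filter_subset _ _
  have hsum : ((W \ T).card : ℝ) + T.card = W.card := by
    exact_mod_cast Finset.card_sdiff_add_card_eq_card hTW
  simp only [Nat.cast_zero, sub_zero] at hTle
  linarith
end

section
/- Let α > 0, m ∈ ℕ, and let S_1,…,S_n be strings over an alphabet Σ' with LCS(S_i,S_j) ≤ α·m for all i ≠ j. Fix i ∈ {1,…,n} and let t_1,…,t_r be indices in {1,…,n} \ {i}. If a string Z is a subsequence of S_i and Z is also a subsequence of the concatenation S_{t_1} S_{t_2} ⋯ S_{t_r}, then |Z| ≤ r·α·m. -/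
theorem le_lcsLen {α : Type*} {S T Z : List α} (h1 : Z.Sublist S) (h2 : Z.Sublist T) :
    Z.length ≤ lcsLen S T := by
  refine le_csSup ⟨S.length, ?_⟩ ⟨Z, h1, h2, rfl⟩
  rintro k ⟨W, hW, _, rfl⟩
  exact hW.length_le

/-- If the strings `S_1, …, S_n` have pairwise LCS at most `α·m`, `Z` is a
subsequence of `S_i`, and `Z` is also a subsequence of a concatenation
`S_{t_1} ⋯ S_{t_r}` with all `t_ℓ ≠ i`, then `|Z| ≤ r·α·m`. -/
theorem stmt17 {n m : ℕ} {A : Type*} (α : ℝ) (hα0 : 0 < α)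
    (S : Fin n → List A)
    (hLCS : ∀ i j : Fin n, i ≠ j → ((lcsLen (S i) (S j) : ℕ) : ℝ) ≤ α * m)
    (i : Fin n) (ts : List (Fin n)) (hts : ∀ t ∈ ts, t ≠ i)
    (Z : List A) (hZi : Z.Sublist (S i)) (hZts : Z.Sublist ((ts.map S).flatten)) :
    (Z.length : ℝ) ≤ (ts.length : ℝ) * α * m := by
  induction ts generalizing Z with
  | nil => simp at hZts; simp [hZts]
  | cons t ts ih =>
    rw [List.map_cons, List.flatten_cons, List.sublist_append_iff] at hZts
    obtain ⟨X, Y, rfl, hX, hY⟩ := hZts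
    have h1 := ih (fun s hs => hts s (List.mem_cons_of_mem _ hs)) Y
      ((List.sublist_append_right X Y).trans hZi) hY
    have h2 := hLCS i t (hts t List.mem_cons_self).symm
    have h3 : (X.length : ℝ) ≤ (lcsLen (S i) (S t) : ℕ) := by
      exact_mod_cast le_lcsLen ((List.sublist_append_left X Y).trans hZi) hX
    simp only [List.length_append, List.length_cons]
    push_cast
    linarith
end
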